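/- arXiv:0804.2833 — 4 statements merged into one kernel-verified Lean document; each statement's English description precedes it below -/
import Mathlib

section
/- Let n ≥ 3, 1 < p < n, 0 ≤ s ≤ p, and set p*(s) = p(n−s)/(n−p). Suppose S > 0 is a constant such that the Sobolev inequality (∫_{ℝⁿ} |φ|^{np/(n−p)} dx)^{(n−p)/(np)} ≤ S (∫_{ℝⁿ} |∇φ|^p dx)^{1/p} holds for all φ ∈ C_c^∞(ℝⁿ). Then for every φ ∈ C_c^∞(ℝⁿ) one has (∫_{ℝⁿ} |φ(x)|^{p*(s)} |x|^{−s} dx)^{1/p*(s)} ≤ (p/(n−p))^{s/p*(s)} · S^{n(p−s)/(p(n−s))} · (∫_{ℝⁿ} |∇φ|^p dx)^{1/p}. -/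
open MeasureTheory

open Module Set in
/-- A compactly supported `C¹` function is controlled by its derivative along the outgoing ray. -/
lemma enorm_le_enorm_mul_lintegral_fderiv_smul {E F : Type*} [NormedAddCommGroup E]
    [NormedSpace ℝ E] [NormedAddCommGroup F] [NormedSpace ℝ F] [CompleteSpace F] {φ : E → F}
    (hφ : ContDiff ℝ 1 φ) (hc : HasCompactSupport φ) {x : E} (hx : x ≠ 0) :
    ‖φ x‖ₑ ≤ ‖x‖ₑ * ∫⁻ t in Ioi (1 : ℝ), ‖fderiv ℝ φ (t • x)‖ₑ := by
  have hray : ContDiff ℝ 1 fun t : ℝ => φ (t • x) := by fun_prop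
  have hcray : HasCompactSupport fun t : ℝ => φ (t • x) :=
    hc.comp_isClosedEmbedding (isClosedEmbedding_smul_left hx)
  have hderiv (t : ℝ) : deriv (fun t : ℝ => φ (t • x)) t = fderiv ℝ φ (t • x) x := by
    have h1 := (hφ.differentiable one_ne_zero (t • x)).hasFDerivAt
    have h2 : HasDerivAt (fun t : ℝ => t • x) x t := by
      simpa using (hasDerivAt_id t).smul_const x
    exact (h1.comp_hasDerivAt t h2).deriv
  have hint := hcray.integral_Ioi_deriv_eq hray 1
  rw [one_smul] at hint
  calc ‖φ x‖ₑ = ‖∫ t in Ioi (1 : ℝ), deriv (fun t : ℝ => φ (t • x)) t‖ₑ := by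
        rw [hint, enorm_neg]
    _ ≤ ∫⁻ t in Ioi (1 : ℝ), ‖deriv (fun t : ℝ => φ (t • x)) t‖ₑ :=
        enorm_integral_le_lintegral_enorm _
    _ ≤ ∫⁻ t in Ioi (1 : ℝ), ‖x‖ₑ * ‖fderiv ℝ φ (t • x)‖ₑ := by
        gcongr with t
        rw [hderiv, mul_comm]
        exact ContinuousLinearMap.le_opENorm _ _
    _ = _ := lintegral_const_mul' _ _ enorm_ne_top

lemma lintegral_comp_smul_of_pos {E : Type*} [NormedAddCommGroup E] [NormedSpace ℝ E]
    [MeasurableSpace E] [BorelSpace E] [FiniteDimensional ℝ E] (μ : Measure E)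
    [μ.IsAddHaarMeasure] (g : E → ENNReal) {t : ℝ} (ht : 0 < t) :
    ∫⁻ x, g (t • x) ∂μ = ENNReal.ofReal (t ^ (-(Module.finrank ℝ E : ℝ))) * ∫⁻ x, g x ∂μ := by
  have h := (MeasurableEquiv.smul₀ t ht.ne').measurableEmbedding.lintegral_map (μ := μ) g
  simp only [MeasurableEquiv.coe_smul₀, Measure.map_addHaar_smul μ ht.ne'] at h
  rw [← h, lintegral_smul_measure, smul_eq_mul, abs_of_pos (by positivity),
    Real.rpow_neg ht.le, Real.rpow_natCast]

lemma lintegral_Ioi_one_rpow {a : ℝ} (ha : a < -1) :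
    ∫⁻ t in Set.Ioi (1 : ℝ), ENNReal.ofReal (t ^ a) = ENNReal.ofReal (-1 / (a + 1)) := by
  rw [← ofReal_integral_eq_lintegral_ofReal (integrableOn_Ioi_rpow_of_lt ha one_pos),
    integral_Ioi_rpow_of_lt ha one_pos, Real.one_rpow]
  filter_upwards [ae_restrict_mem measurableSet_Ioi] with t ht
  exact Real.rpow_nonneg (zero_le_one.trans (le_of_lt ht)) _

open Module Set in
/-- `Lᵖ` bound for the averaging operator `g ↦ ∫₁^∞ g(t·) dt`. -/
lemma lintegral_rpow_lintegral_Ioi_smul_le {E : Type*} [NormedAddCommGroup E] [NormedSpace ℝ E]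
    [MeasurableSpace E] [BorelSpace E] [FiniteDimensional ℝ E] (μ : Measure E)
    [μ.IsAddHaarMeasure] {g : E → ENNReal} (hg : Measurable g) {p : ℝ} (hp : 1 < p)
    (hpd : p < finrank ℝ E) :
    ∫⁻ x, (∫⁻ t in Ioi (1 : ℝ), g (t • x)) ^ p ∂μ ≤
      ENNReal.ofReal (p / (finrank ℝ E - p)) ^ p * ∫⁻ x, g x ^ p ∂μ := by
  set d : ℝ := (finrank ℝ E : ℝ) with hd
  have hp0 : 0 < p := by linarith
  have hdp : 0 < d - p := by linarith
  have hpq := Real.HolderConjugate.conjExponent hp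
  set q := p.conjExponent with hq
  have hq0 : 0 < q := hpq.symm.pos
  set a : ℝ := d / (p * q) with ha
  have haq : a * q = d / p := by rw [ha]; field_simp
  have hap : a * p - d = -(d / p) := by
    have : p + q = p * q := hpq.mul_eq_add.symm
    have : a * p + a * q = d := by rw [← mul_add, this, ha]; field_simp
    linarith
  have hdp1 : -(d / p) < -1 := by
    have : 1 < d / p := (one_lt_div hp0).2 hpd
    linarith
  set C := ENNReal.ofReal (p / (d - p)) with hC
  have hI : ∫⁻ t in Ioi (1 : ℝ), ENNReal.ofReal (t ^ (-(d / p))) = C := by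
    rw [lintegral_Ioi_one_rpow hdp1, hC]
    congr 1
    have : -(d / p) + 1 = -((d - p) / p) := by field_simp; ring
    rw [this, neg_div_neg_eq, one_div_div]
  have hgm : Measurable fun z : E × ℝ => g (z.2 • z.1) := hg.comp (by fun_prop)
  have holder (x : E) : (∫⁻ t in Ioi (1 : ℝ), g (t • x)) ^ p ≤
      (∫⁻ t in Ioi (1 : ℝ), g (t • x) ^ p * ENNReal.ofReal (t ^ (a * p))) * C ^ (p / q) := by
    have key := ENNReal.lintegral_mul_le_Lp_mul_Lq (volume.restrict (Ioi (1 : ℝ))) hpq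
      (f := fun t => g (t • x) * ENNReal.ofReal (t ^ a)) (g := fun t => ENNReal.ofReal (t ^ (-a)))
      ((hg.comp (by fun_prop)).mul (by fun_prop)).aemeasurable (by fun_prop)
    have e1 : ∫⁻ t in Ioi (1 : ℝ), ((fun t => g (t • x) * ENNReal.ofReal (t ^ a)) *
        fun t => ENNReal.ofReal (t ^ (-a))) t = ∫⁻ t in Ioi (1 : ℝ), g (t • x) := by
      refine setLIntegral_congr_fun measurableSet_Ioi fun t ht => ?_
      have ht : 0 < t := one_pos.trans ht
      simp only [Pi.mul_apply]
      rw [mul_assoc, ← ENNReal.ofReal_mul (by positivity), ← Real.rpow_add ht]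
      simp
    have e2 : ∫⁻ t in Ioi (1 : ℝ), (g (t • x) * ENNReal.ofReal (t ^ a)) ^ p =
        ∫⁻ t in Ioi (1 : ℝ), g (t • x) ^ p * ENNReal.ofReal (t ^ (a * p)) := by
      refine setLIntegral_congr_fun measurableSet_Ioi fun t ht => ?_
      have ht : 0 < t := one_pos.trans ht
      rw [ENNReal.mul_rpow_of_nonneg _ _ hp0.le,
        ENNReal.ofReal_rpow_of_nonneg (by positivity) hp0.le, ← Real.rpow_mul ht.le]
    have e3 : ∫⁻ t in Ioi (1 : ℝ), ENNReal.ofReal (t ^ (-a)) ^ q = C := by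
      rw [← hI]
      refine setLIntegral_congr_fun measurableSet_Ioi fun t ht => ?_
      have ht : 0 < t := one_pos.trans ht
      rw [ENNReal.ofReal_rpow_of_nonneg (by positivity) hq0.le, ← Real.rpow_mul ht.le,
        neg_mul, haq]
    rw [e1, e2, e3] at key
    calc _ ≤ _ := ENNReal.rpow_le_rpow key hp0.le
      _ = _ := by
        rw [ENNReal.mul_rpow_of_nonneg _ _ hp0.le, ← ENNReal.rpow_mul, ← ENNReal.rpow_mul,
          one_div_mul_cancel hp0.ne', ENNReal.rpow_one, one_div_mul_eq_div]
  calc ∫⁻ x, (∫⁻ t in Ioi (1 : ℝ), g (t • x)) ^ p ∂μ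
      ≤ ∫⁻ x, (∫⁻ t in Ioi (1 : ℝ), g (t • x) ^ p * ENNReal.ofReal (t ^ (a * p))) *
          C ^ (p / q) ∂μ := lintegral_mono holder
    _ = (∫⁻ t in Ioi (1 : ℝ), ∫⁻ x, g (t • x) ^ p * ENNReal.ofReal (t ^ (a * p)) ∂μ) *
          C ^ (p / q) := by
        rw [lintegral_mul_const' _ _ (by finiteness), lintegral_lintegral_swap]
        exact ((hgm.pow_const p).mul (by fun_prop)).aemeasurable
    _ = (∫⁻ t in Ioi (1 : ℝ), ENNReal.ofReal (t ^ (-(d / p))) * ∫⁻ x, g x ^ p ∂μ) *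
          C ^ (p / q) := by
        congr 1
        refine setLIntegral_congr_fun measurableSet_Ioi fun t ht => ?_
        have ht : 0 < t := one_pos.trans ht
        rw [lintegral_mul_const' _ _ (by finiteness),
          lintegral_comp_smul_of_pos μ (fun x => g x ^ p) ht, mul_right_comm,
          ← ENNReal.ofReal_mul (by positivity), ← Real.rpow_add ht, ← hd, ← hap]
        ring_nf
    _ = C ^ p * ∫⁻ x, g x ^ p ∂μ := by
        rw [lintegral_mul_const _ (by fun_prop), hI, mul_right_comm]
        congr 1
        nth_rw 1 [← ENNReal.rpow_one C]
        rw [← ENNReal.rpow_add_of_nonneg _ _ zero_le_one (by positivity)]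
        congr 1
        have : p + q = p * q := hpq.mul_eq_add.symm
        field_simp
        linarith

open Module in
/-- **Hardy's inequality** with the sharp constant. -/
lemma lintegral_rpow_enorm_div_enorm_le {E F : Type*} [NormedAddCommGroup E] [NormedSpace ℝ E]
    [MeasurableSpace E] [BorelSpace E] [FiniteDimensional ℝ E] [NormedAddCommGroup F]
    [NormedSpace ℝ F] [CompleteSpace F] (μ : Measure E) [μ.IsAddHaarMeasure] {φ : E → F}
    (hφ : ContDiff ℝ 1 φ) (hc : HasCompactSupport φ) {p : ℝ} (hp : 1 < p)
    (hpd : p < finrank ℝ E) :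
    ∫⁻ x, (‖φ x‖ₑ / ‖x‖ₑ) ^ p ∂μ ≤
      ENNReal.ofReal (p / (finrank ℝ E - p)) ^ p * ∫⁻ x, ‖fderiv ℝ φ x‖ₑ ^ p ∂μ := by
  have hdim : (0 : ℝ) < finrank ℝ E := by linarith
  have : Nontrivial E := finrank_pos_iff.1 (by exact_mod_cast hdim)
  have hmeas : Measurable fun x => ‖fderiv ℝ φ x‖ₑ :=
    (hφ.continuous_fderiv one_ne_zero).enorm.measurable
  refine le_trans (lintegral_mono_ae ?_) (lintegral_rpow_lintegral_Ioi_smul_le μ hmeas hp hpd)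
  filter_upwards [Measure.ae_ne μ 0] with x hx
  refine ENNReal.rpow_le_rpow (ENNReal.div_le_of_le_mul' ?_) (by linarith)
  exact enorm_le_enorm_mul_lintegral_fderiv_smul hφ hc hx

/-- Interpolation of a weighted integral between a Hardy term and an unweighted one. -/
lemma lintegral_rpow_enorm_mul_enorm_rpow_neg_le {E F : Type*} [NormedAddCommGroup E]
    [MeasurableSpace E] [BorelSpace E] [NormedAddCommGroup F] (μ : Measure E)
    {φ : E → F} (hφ : Continuous φ) {p s r : ℝ} (hp : 0 < p) (hs : 0 ≤ s) (hsp : s ≤ p)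
    (hr : 0 ≤ r) :
    ∫⁻ x, ‖φ x‖ₑ ^ (s + r * ((p - s) / p)) * ‖x‖ₑ ^ (-s) ∂μ ≤
      (∫⁻ x, (‖φ x‖ₑ / ‖x‖ₑ) ^ p ∂μ) ^ (s / p) * (∫⁻ x, ‖φ x‖ₑ ^ r ∂μ) ^ ((p - s) / p) := by
  have hθ : 0 ≤ (p - s) / p := div_nonneg (by linarith) hp.le
  refine le_trans (le_of_eq ?_) (ENNReal.lintegral_mul_norm_pow_le
    (f := fun x => (‖φ x‖ₑ / ‖x‖ₑ) ^ p) (g := fun x => ‖φ x‖ₑ ^ r) (μ := μ)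
    (by borelize F; fun_prop) (by borelize F; fun_prop) (by positivity) hθ (by field_simp; ring))
  refine lintegral_congr fun x => ?_
  rw [← ENNReal.rpow_mul, ← ENNReal.rpow_mul, mul_div_cancel₀ _ hp.ne', div_eq_mul_inv ‖φ x‖ₑ,
    ENNReal.mul_rpow_of_nonneg _ _ hs, ENNReal.rpow_add_of_nonneg _ _ hs (by positivity),
    ENNReal.inv_rpow, ENNReal.rpow_neg]
  ring

lemma ofReal_integral_norm_rpow {E F : Type*} [TopologicalSpace E] [MeasurableSpace E]
    [OpensMeasurableSpace E] [NormedAddCommGroup F] (μ : Measure E) [IsFiniteMeasureOnCompacts μ]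
    {f : E → F} (hf : Continuous f) (hc : HasCompactSupport f) {r : ℝ} (hr : 0 < r) :
    ENNReal.ofReal (∫ x, ‖f x‖ ^ r ∂μ) = ∫⁻ x, ‖f x‖ₑ ^ r ∂μ := by
  have hcont : Continuous fun x => ‖f x‖ ^ r := hf.norm.rpow_const fun _ => Or.inr hr.le
  have hcomp : HasCompactSupport fun x => ‖f x‖ ^ r :=
    hc.comp_left (g := fun y : F => ‖y‖ ^ r) (by simp [hr.ne'])
  rw [ofReal_integral_eq_lintegral_ofReal (hcont.integrable_of_hasCompactSupport hcomp)
    (.of_forall fun x => by positivity)]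
  refine lintegral_congr fun x => ?_
  rw [← ENNReal.ofReal_rpow_of_nonneg (norm_nonneg _) hr.le, ofReal_norm]

/-- **Hardy–Sobolev inequality.** If the Sobolev inequality holds with constant `S`,
then for `0 ≤ s ≤ p` and `p*(s) = p(n-s)/(n-p)` the Hardy–Sobolev inequality holds with
constant `(p/(n-p))^(s/p*(s)) · S^(n(p-s)/(p(n-s)))`. -/
theorem hardy_sobolev_interpolation (n : ℕ) (hn : 3 ≤ n) (p s S : ℝ)
    (hp : 1 < p) (hpn : p < n) (hs0 : 0 ≤ s) (hsp : s ≤ p) (hS : 0 < S)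
    (hSob : ∀ φ : EuclideanSpace ℝ (Fin n) → ℝ, ContDiff ℝ (⊤ : ℕ∞) φ → HasCompactSupport φ →
      (∫ x, |φ x| ^ ((n : ℝ) * p / ((n : ℝ) - p))) ^ (((n : ℝ) - p) / ((n : ℝ) * p)) ≤
        S * (∫ x, ‖fderiv ℝ φ x‖ ^ p) ^ (1 / p)) :
    ∀ φ : EuclideanSpace ℝ (Fin n) → ℝ, ContDiff ℝ (⊤ : ℕ∞) φ → HasCompactSupport φ →
      (∫ x, |φ x| ^ (p * ((n : ℝ) - s) / ((n : ℝ) - p)) * ‖x‖ ^ (-s)) ^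
          (1 / (p * ((n : ℝ) - s) / ((n : ℝ) - p))) ≤
        (p / ((n : ℝ) - p)) ^ (s / (p * ((n : ℝ) - s) / ((n : ℝ) - p))) *
          S ^ ((n : ℝ) * (p - s) / (p * ((n : ℝ) - s))) *
          (∫ x, ‖fderiv ℝ φ x‖ ^ p) ^ (1 / p) := by
  intro φ hφ hc
  have hp0 : 0 < p := by linarith
  have hnp : 0 < (n : ℝ) - p := by linarith
  have hns : 0 < (n : ℝ) - s := by linarith
  have hn0 : 0 < (n : ℝ) := by linarith
  have hφ1 : ContDiff ℝ 1 φ := hφ.of_le (by exact_mod_cast le_top)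
  have : Nontrivial (EuclideanSpace ℝ (Fin n)) :=
    Module.finrank_pos_iff (R := ℝ).1 (by rw [finrank_euclideanSpace_fin]; omega)
  set r : ℝ := (n : ℝ) * p / ((n : ℝ) - p) with hr
  set P : ℝ := p * ((n : ℝ) - s) / ((n : ℝ) - p) with hP
  have hr0 : 0 < r := by positivity
  have hP0 : 0 < P := by positivity
  have hPr : s + r * ((p - s) / p) = P := by rw [hr, hP]; field_simp; ring
  set D := ∫ x, ‖fderiv ℝ φ x‖ ^ p with hD
  set A := ∫ x, |φ x| ^ r with hA
  set c := p / ((n : ℝ) - p)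
  have hD0 : 0 ≤ D := integral_nonneg fun x => by positivity
  have hA0 : 0 ≤ A := integral_nonneg fun x => by positivity
  have hc0 : 0 < c := by positivity
  have hθ : 0 ≤ (p - s) / p := div_nonneg (by linarith) hp0.le
  have hDe := ofReal_integral_norm_rpow volume (hφ1.continuous_fderiv one_ne_zero)
    (hc.fderiv ℝ) hp0
  have hAe := ofReal_integral_norm_rpow volume hφ1.continuous hc hr0
  have hardy := lintegral_rpow_enorm_div_enorm_le volume hφ1 hc hp
    (by rwa [finrank_euclideanSpace_fin])
  rw [finrank_euclideanSpace_fin, ← hDe, ENNReal.ofReal_rpow_of_nonneg hc0.le hp0.le,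
    ← ENNReal.ofReal_mul (by positivity)] at hardy
  have interp := lintegral_rpow_enorm_mul_enorm_rpow_neg_le volume hφ1.continuous hp0 hs0 hsp
    hr0.le
  rw [hPr, ← hAe] at interp
  have bound : ∫ x, |φ x| ^ P * ‖x‖ ^ (-s) ≤ (c ^ p * D) ^ (s / p) * A ^ ((p - s) / p) := by
    have hmeas : Measurable fun x => |φ x| ^ P * ‖x‖ ^ (-s) :=
      (hφ1.continuous.abs.measurable.pow_const _).mul (measurable_norm.pow_const _)
    rw [integral_eq_lintegral_of_nonneg_ae (.of_forall fun x => by positivity)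
      hmeas.aestronglyMeasurable]
    refine ENNReal.toReal_le_of_le_ofReal (by positivity) ?_
    rw [ENNReal.ofReal_mul (by positivity), ← ENNReal.ofReal_rpow_of_nonneg (by positivity)
      (by positivity), ← ENNReal.ofReal_rpow_of_nonneg hA0 hθ]
    refine le_trans (lintegral_mono_ae ?_) (interp.trans ?_)
    · filter_upwards [Measure.ae_ne volume (0 : EuclideanSpace ℝ (Fin n))] with x hx
      rw [ENNReal.ofReal_mul (by positivity), ← ENNReal.ofReal_rpow_of_nonneg (abs_nonneg _) hP0.le,
        ← ENNReal.ofReal_rpow_of_pos (norm_pos_iff.2 hx), ofReal_norm, ← Real.norm_eq_abs,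
        ofReal_norm]
    · exact mul_le_mul_left (ENNReal.rpow_le_rpow hardy (by positivity)) _
  have sob : A ^ (1 / r) ≤ S * D ^ (1 / p) := by
    simpa only [hr, hA, one_div_div] using hSob φ hφ hc
  have hA' : A ≤ (S * D ^ (1 / p)) ^ r := by
    calc A = (A ^ (1 / r)) ^ r := by
          rw [← Real.rpow_mul hA0, one_div_mul_cancel hr0.ne', Real.rpow_one]
      _ ≤ _ := Real.rpow_le_rpow (by positivity) sob hr0.le
  calc (∫ x, |φ x| ^ P * ‖x‖ ^ (-s)) ^ (1 / P)
      ≤ ((c ^ p * D) ^ (s / p) * ((S * D ^ (1 / p)) ^ r) ^ ((p - s) / p)) ^ (1 / P) := by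
        refine Real.rpow_le_rpow (integral_nonneg fun x => by positivity) (bound.trans ?_)
          (by positivity)
        gcongr
    _ = c ^ (s / P) * S ^ ((n : ℝ) * (p - s) / (p * ((n : ℝ) - s))) * D ^ (1 / p) := by
        set B := D ^ (1 / p) with hB
        have hB0 : 0 ≤ B := by positivity
        have hDB : D = B ^ p := by
          rw [hB, ← Real.rpow_mul hD0, one_div_mul_cancel hp0.ne', Real.rpow_one]
        have e1 : (c ^ p * D) ^ (s / p) = c ^ s * B ^ s := by
          rw [hDB, ← Real.mul_rpow hc0.le hB0, ← Real.rpow_mul (by positivity),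
            mul_div_cancel₀ _ hp0.ne', Real.mul_rpow hc0.le hB0]
        have e2 : ((S * B) ^ r) ^ ((p - s) / p) = S ^ (P - s) * B ^ (P - s) := by
          rw [← Real.rpow_mul (by positivity), Real.mul_rpow hS.le hB0, ← hPr,
            add_sub_cancel_left]
        have hPs : 0 ≤ P - s := by rw [← hPr, add_sub_cancel_left]; positivity
        have e3 : (n : ℝ) * (p - s) / (p * ((n : ℝ) - s)) = (P - s) * (1 / P) := by
          rw [hP]; field_simp; ring
        have e4 : c ^ s * B ^ s * (S ^ (P - s) * B ^ (P - s)) = c ^ s * S ^ (P - s) * B ^ P := by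
          rw [mul_mul_mul_comm, ← Real.rpow_add_of_nonneg hB0 hs0 hPs, add_sub_cancel]
        rw [e1, e2, e3, e4, Real.mul_rpow (by positivity) (by positivity),
          Real.mul_rpow (by positivity) (by positivity), ← Real.rpow_mul hc0.le,
          ← Real.rpow_mul hS.le, ← Real.rpow_mul hB0, mul_one_div_cancel hP0.ne', Real.rpow_one,
          mul_one_div]
end

section
/- Let n ≥ 3 and 1 < p < n. Then for every φ ∈ C_c^∞(ℝⁿ) one has the Hardy inequality ∫_{ℝⁿ} |φ(x)|^p |x|^{−p} dx ≤ (p/(n−p))^p ∫_{ℝⁿ} |∇φ(x)|^p dx. -/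
open MeasureTheory

open Filter Topology

/-- Euler's dilation identity: `∫ x · ∇h = -n ∫ h`. -/
theorem integral_fderiv_apply_self {n : ℕ} {h : EuclideanSpace ℝ (Fin n) → ℝ}
    (hh : ContDiff ℝ 1 h) (hc : HasCompactSupport h) :
    ∫ x, fderiv ℝ h x x = -(n * ∫ x, h x) := by
  have hfd : Continuous (fderiv ℝ h) := hh.continuous_fderiv one_ne_zero
  have hcd : HasCompactSupport (fderiv ℝ h) := hc.fderiv ℝ
  let e : Fin n → EuclideanSpace ℝ (Fin n) := fun i => EuclideanSpace.single i 1
  have hint : ∀ i, Integrable fun x => fderiv ℝ h x (e i) * x i := fun i =>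
    Continuous.integrable_of_hasCompactSupport (by fun_prop)
      (hcd.mono fun x hx => by
        contrapose! hx
        simp_all)
  have key : ∀ i, ∫ x, fderiv ℝ h x (e i) * x i = -∫ x, h x := by
    intro i
    let π : EuclideanSpace ℝ (Fin n) →L[ℝ] ℝ := EuclideanSpace.proj i
    have hπ : ∀ x, fderiv ℝ (fun x => π x) x = π := fun x => π.hasFDerivAt.fderiv
    have hπe : π (e i) = 1 := by simp [π, e]
    have := integral_mul_fderiv_eq_neg_fderiv_mul_of_integrable (μ := volume) (v := e i)
      (f := h) (g := fun x => π x) (hint i) ?_ ?_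
      (fun x _ => hh.differentiable one_ne_zero x) (fun x _ => π.differentiable x)
    · simp only [hπ, hπe, mul_one] at this
      rw [this, neg_neg]
      rfl
    · simp only [hπ]
      exact Continuous.integrable_of_hasCompactSupport (by fun_prop) hc.mul_right
    · exact Continuous.integrable_of_hasCompactSupport (by fun_prop) hc.mul_right
  have hsum : ∀ x, fderiv ℝ h x x = ∑ i, fderiv ℝ h x (e i) * x i := by
    intro x
    have := congrArg (fderiv ℝ h x) ((EuclideanSpace.basisFun (Fin n) ℝ).sum_repr x)
    rw [← this, map_sum]
    simp [e, mul_comm]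
  simp_rw [hsum]
  rw [integral_finsetSum _ fun i _ => hint i]
  simp [key]

/-- Young's inequality with a parameter. -/
theorem mul_rpow_sub_one_mul_le {p c t d : ℝ} (hp : 1 < p) (hc : 0 < c) (ht : 0 ≤ t)
    (hd : 0 ≤ d) :
    p * t ^ (p - 1) * d ≤ (p - 1) * c * t ^ p + c ^ (1 - p) * d ^ p := by
  have hp0 : 0 < p := by linarith
  have hp1 : 0 < p - 1 := by linarith
  have hpq : p.HolderConjugate (p / (p - 1)) := Real.HolderConjugate.conjExponent hp
  have h := Real.young_inequality_of_nonneg (a := c ^ (-((p - 1) / p)) * d)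
    (b := c ^ ((p - 1) / p) * t ^ (p - 1)) (by positivity) (by positivity) hpq
  rw [Real.mul_rpow (by positivity) hd, Real.mul_rpow (by positivity) (by positivity),
    ← Real.rpow_mul hc.le, ← Real.rpow_mul hc.le, ← Real.rpow_mul ht,
    show -((p - 1) / p) * p = 1 - p by field_simp; ring,
    show (p - 1) / p * (p / (p - 1)) = 1 by field_simp,
    show (p - 1) * (p / (p - 1)) = p by field_simp, Real.rpow_one] at h
  have h1 : c ^ (-((p - 1) / p)) * c ^ ((p - 1) / p) = 1 := by
    rw [← Real.rpow_add hc]; simp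
  have h2 : c ^ (-((p - 1) / p)) * d * (c ^ ((p - 1) / p) * t ^ (p - 1)) = t ^ (p - 1) * d := by
    linear_combination (t ^ (p - 1) * d) * h1
  rw [h2] at h
  calc p * t ^ (p - 1) * d = p * (t ^ (p - 1) * d) := by ring
    _ ≤ p * (c ^ (1 - p) * d ^ p / p + c * t ^ p / (p / (p - 1))) := by gcongr
    _ = _ := by field_simp; ring

theorem norm_sq_add_rpow_mul_norm_le {E : Type*} [NormedAddCommGroup E] {ε : ℝ}
    (hε : 0 < ε) (p : ℝ) (x : E) :
    (‖x‖ ^ 2 + ε) ^ (-(p / 2)) * ‖x‖ ≤ ((‖x‖ ^ 2 + ε) ^ (-(1 / 2) : ℝ)) ^ (p - 1) := by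
  have hS : 0 < ‖x‖ ^ 2 + ε := by positivity
  have hr : ‖x‖ ≤ (‖x‖ ^ 2 + ε) ^ (1 / 2 : ℝ) := by
    rw [← Real.sqrt_eq_rpow]
    exact Real.le_sqrt_of_sq_le (by linarith)
  calc _ ≤ (‖x‖ ^ 2 + ε) ^ (-(p / 2)) * (‖x‖ ^ 2 + ε) ^ (1 / 2 : ℝ) := by gcongr
    _ = _ := by
      rw [← Real.rpow_add hS, ← Real.rpow_mul hS.le]
      ring_nf

section Regularized

variable {E : Type*} [NormedAddCommGroup E] [InnerProductSpace ℝ E]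

theorem contDiff_norm_sq_add_rpow {ε : ℝ} (hε : 0 < ε) (q : ℝ) :
    ContDiff ℝ 1 fun x : E => (‖x‖ ^ 2 + ε) ^ q :=
  ((contDiff_norm_sq ℝ).add contDiff_const).rpow_const_of_ne fun x => by positivity

theorem neg_fderiv_norm_sq_add_rpow_apply_self_le {ε p : ℝ} (hε : 0 < ε) (hp : 0 < p) (x : E) :
    -fderiv ℝ (fun x : E => (‖x‖ ^ 2 + ε) ^ (-(p / 2))) x x ≤
      p * (‖x‖ ^ 2 + ε) ^ (-(p / 2)) := by
  have hS : 0 < ‖x‖ ^ 2 + ε := by positivity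
  have h : HasFDerivAt (fun x : E => (‖x‖ ^ 2 + ε) ^ (-(p / 2))) _ x :=
    ((hasStrictFDerivAt_norm_sq x).hasFDerivAt.add_const ε).rpow_const (Or.inl hS.ne')
  rw [h.fderiv]
  have e1 : (‖x‖ ^ 2 + ε) ^ (-(p / 2)) = (‖x‖ ^ 2 + ε) ^ (-(p / 2) - 1) * (‖x‖ ^ 2 + ε) := by
    rw [Real.rpow_sub_one hS.ne']; field_simp
  have h2 : 0 ≤ p * (‖x‖ ^ 2 + ε) ^ (-(p / 2) - 1) * ε := by positivity
  rw [e1]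
  simp
  nlinarith

/-- Pointwise estimate of the dilation derivative of `|φ|^p (|x|² + ε)^{-p/2}`. -/
theorem neg_fderiv_abs_rpow_mul_apply_self_le {φ : E → ℝ} (hφ : ContDiff ℝ 1 φ) {ε p c : ℝ}
    (hε : 0 < ε) (hp : 1 < p) (hc : 0 < c) (x : E) :
    -fderiv ℝ (fun x => |φ x| ^ p * (‖x‖ ^ 2 + ε) ^ (-(p / 2))) x x ≤
      (p + (p - 1) * c) * (|φ x| ^ p * (‖x‖ ^ 2 + ε) ^ (-(p / 2))) +
        c ^ (1 - p) * ‖fderiv ℝ φ x‖ ^ p := by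
  have hS : 0 < ‖x‖ ^ 2 + ε := by positivity
  have hu : ContDiff ℝ 1 fun x => |φ x| ^ p := by simpa using hφ.norm_rpow hp
  have hu' : ‖fderiv ℝ (fun x => |φ x| ^ p) x‖ ≤ p * |φ x| ^ (p - 1) * ‖fderiv ℝ φ x‖ := by
    simpa using norm_fderiv_norm_rpow_le (hφ.differentiable one_ne_zero) (x := x) hp
  rw [fderiv_fun_mul (hu.differentiable one_ne_zero x)
    ((contDiff_norm_sq_add_rpow hε _).differentiable one_ne_zero x)]
  have h1 := neg_fderiv_norm_sq_add_rpow_apply_self_le hε (zero_lt_one.trans hp) x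
  have h2 := norm_sq_add_rpow_mul_norm_le hε p x
  have h3 : -fderiv ℝ (fun x => |φ x| ^ p) x x ≤
      p * |φ x| ^ (p - 1) * ‖fderiv ℝ φ x‖ * ‖x‖ :=
    (neg_le_abs _).trans <| (ContinuousLinearMap.le_opNorm _ x).trans <|
      mul_le_mul_of_nonneg_right hu' (norm_nonneg x)
  have hw : (‖x‖ ^ 2 + ε) ^ (-(p / 2)) = ((‖x‖ ^ 2 + ε) ^ (-(1 / 2) : ℝ)) ^ p := by
    rw [← Real.rpow_mul hS.le]; ring_nf
  have h4 := mul_rpow_sub_one_mul_le hp hc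
    (t := |φ x| * (‖x‖ ^ 2 + ε) ^ (-(1 / 2) : ℝ)) (by positivity) (norm_nonneg (fderiv ℝ φ x))
  rw [Real.mul_rpow (by positivity) (by positivity),
    Real.mul_rpow (by positivity) (by positivity), ← hw] at h4
  have hw0 : 0 ≤ (‖x‖ ^ 2 + ε) ^ (-(p / 2)) := by positivity
  have h5 := mul_le_mul_of_nonneg_left h3 hw0
  have h6 : 0 ≤ p * |φ x| ^ (p - 1) * ‖fderiv ℝ φ x‖ := by positivity
  have h7 := mul_le_mul_of_nonneg_left h2 h6
  have h8 := mul_le_mul_of_nonneg_left h1 (show 0 ≤ |φ x| ^ p by positivity)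
  simp only [add_apply, smul_apply, smul_eq_mul]
  linarith

end Regularized

/-- Hardy's inequality with the regularized weight `(|x|² + ε)^{-p/2}`. -/
theorem integral_abs_rpow_mul_norm_sq_add_rpow_le {n : ℕ} {p ε : ℝ} (hp : 1 < p) (hpn : p < n)
    (hε : 0 < ε) {φ : EuclideanSpace ℝ (Fin n) → ℝ} (hφ : ContDiff ℝ 1 φ)
    (hφc : HasCompactSupport φ) :
    ∫ x, |φ x| ^ p * (‖x‖ ^ 2 + ε) ^ (-(p / 2)) ≤
      (p / ((n : ℝ) - p)) ^ p * ∫ x, ‖fderiv ℝ φ x‖ ^ p := by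
  have hp0 : 0 < p := by linarith
  have hnp : 0 < (n : ℝ) - p := by linarith
  set c : ℝ := (n - p) / p with hc_def
  have hc : 0 < c := by positivity
  set h : EuclideanSpace ℝ (Fin n) → ℝ := fun x => |φ x| ^ p * (‖x‖ ^ 2 + ε) ^ (-(p / 2))
  have hu : ContDiff ℝ 1 fun x => |φ x| ^ p := by simpa using hφ.norm_rpow hp
  have hh : ContDiff ℝ 1 h := hu.mul (contDiff_norm_sq_add_rpow hε _)
  have hhc : HasCompactSupport h := hφc.mono fun x hx => by
    contrapose! hx
    simp_all [h, hp0.ne']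
  have hhi : Integrable h := hh.continuous.integrable_of_hasCompactSupport hhc
  have hfd : Continuous (fderiv ℝ h) := hh.continuous_fderiv one_ne_zero
  have hdi : Integrable fun x => fderiv ℝ h x x :=
    Continuous.integrable_of_hasCompactSupport (by fun_prop)
      ((hhc.fderiv ℝ).mono fun x hx => by
        contrapose! hx
        simp_all)
  have hgi : Integrable fun x => ‖fderiv ℝ φ x‖ ^ p :=
    Continuous.integrable_of_hasCompactSupport
      ((hφ.continuous_fderiv one_ne_zero).norm.rpow_const fun _ => Or.inr hp0.le)
      ((hφc.fderiv ℝ).mono fun x hx => by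
        contrapose! hx
        simp_all [hp0.ne'])
  have key : ∫ x, -fderiv ℝ h x x ≤
      ∫ x, ((p + (p - 1) * c) * h x + c ^ (1 - p) * ‖fderiv ℝ φ x‖ ^ p) :=
    integral_mono hdi.neg ((hhi.const_mul _).add (hgi.const_mul _))
      (neg_fderiv_abs_rpow_mul_apply_self_le hφ hε hp hc)
  rw [integral_neg, integral_fderiv_apply_self hh hhc, neg_neg,
    integral_add (hhi.const_mul _) (hgi.const_mul _), integral_const_mul,
    integral_const_mul] at key
  have hn : (n : ℝ) = p + p * c := by rw [hc_def]; field_simp; ring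
  rw [hn] at key
  have hcA : c * ∫ x, h x ≤ c ^ (1 - p) * ∫ x, ‖fderiv ℝ φ x‖ ^ p := by linarith
  have hcp : (p / ((n : ℝ) - p)) ^ p = c⁻¹ * c ^ (1 - p) := by
    rw [← inv_div, ← hc_def, Real.inv_rpow hc.le, Real.rpow_sub hc, Real.rpow_one]
    field_simp
  calc ∫ x, h x = c⁻¹ * (c * ∫ x, h x) := by field_simp
    _ ≤ c⁻¹ * (c ^ (1 - p) * ∫ x, ‖fderiv ℝ φ x‖ ^ p) := by gcongr
    _ = _ := by rw [hcp, mul_assoc]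

/-- **Hardy's inequality** in `ℝⁿ` for `1 < p < n`:
`∫ |φ|^p |x|^{-p} ≤ (p/(n-p))^p ∫ |∇φ|^p` for all `φ ∈ C_c^∞(ℝⁿ)`. -/
theorem hardy_inequality (n : ℕ) (hn : 3 ≤ n) (p : ℝ) (hp : 1 < p) (hpn : p < n) :
    ∀ φ : EuclideanSpace ℝ (Fin n) → ℝ, ContDiff ℝ (⊤ : ℕ∞) φ → HasCompactSupport φ →
      (∫ x, |φ x| ^ p * ‖x‖ ^ (-p)) ≤
        (p / ((n : ℝ) - p)) ^ p * ∫ x, ‖fderiv ℝ φ x‖ ^ p := by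
  intro φ hφ hφc
  have hp0 : 0 < p := by linarith
  have hφ1 : ContDiff ℝ 1 φ := hφ.of_le (by exact_mod_cast le_top)
  by_cases hi : Integrable fun x => |φ x| ^ p * ‖x‖ ^ (-p)
  swap
  · rw [integral_undef hi]
    have : 0 < (n : ℝ) - p := by linarith
    exact mul_nonneg (by positivity) (integral_nonneg fun x => by positivity)
  have : Nonempty (Fin n) := ⟨⟨0, by omega⟩⟩
  have hne : ∀ᵐ x : EuclideanSpace ℝ (Fin n), x ≠ 0 := by
    simp [ae_iff]
  have hpow : ∀ x : EuclideanSpace ℝ (Fin n), (‖x‖ ^ 2) ^ (-(p / 2)) = ‖x‖ ^ (-p) := fun x => by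
    rw [← Real.rpow_natCast, ← Real.rpow_mul (norm_nonneg x)]
    congr 1
    push_cast
    ring
  have hlim : Tendsto (fun ε : ℝ => ∫ x, |φ x| ^ p * (‖x‖ ^ 2 + ε) ^ (-(p / 2))) (𝓝[>] 0)
      (𝓝 (∫ x, |φ x| ^ p * ‖x‖ ^ (-p))) := by
    refine tendsto_integral_filter_of_dominated_convergence _ ?_ ?_ hi ?_
    · filter_upwards [self_mem_nhdsWithin] with ε hε
      exact ((hφ.continuous.abs.rpow_const fun _ => Or.inr hp0.le).mul
        (contDiff_norm_sq_add_rpow hε _).continuous).aestronglyMeasurable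
    · filter_upwards [self_mem_nhdsWithin] with ε (hε : 0 < ε)
      filter_upwards [hne] with x hx
      rw [Real.norm_of_nonneg (by positivity), ← hpow]
      have : 0 < ‖x‖ := norm_pos_iff.2 hx
      gcongr ?_ * ?_
      exact Real.rpow_le_rpow_of_nonpos (by positivity) (by linarith) (by linarith)
    · filter_upwards [hne] with x hx
      have hx2 : ‖x‖ ^ 2 + 0 ≠ 0 := by simpa using hx
      have hcont : ContinuousAt (fun ε : ℝ => |φ x| ^ p * (‖x‖ ^ 2 + ε) ^ (-(p / 2))) 0 :=
        continuousAt_const.mul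
          ((continuousAt_const.add continuousAt_id).rpow_const (Or.inl hx2))
      have := hcont.tendsto.mono_left (nhdsWithin_le_nhds (s := Set.Ioi 0))
      rwa [add_zero, hpow] at this
  refine le_of_tendsto hlim ?_
  filter_upwards [self_mem_nhdsWithin] with ε hε
  exact integral_abs_rpow_mul_norm_sq_add_rpow_le hp hpn hε hφ1 hφc
end

section
/- Let n ≥ 3, 1 < p < n, and R > 0. The constant (p/(n−p))^p in the Hardy inequality on the ball B(0,R) is best possible: for every constant C < (p/(n−p))^p there exists φ ∈ C_c^∞(B(0,R)), φ not identically zero, such that ∫_{B(0,R)} |φ(x)|^p |x|^{−p} dx > C ∫_{B(0,R)} |∇φ(x)|^p dx. -/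
open MeasureTheory Metric

section LogRadial

/-- Polar coordinates in the logarithmic radial variable. -/
theorem integral_norm_rpow_neg_finrank_mul_comp_log {E : Type*} [NormedAddCommGroup E]
    [NormedSpace ℝ E] [MeasurableSpace E] [BorelSpace E] [FiniteDimensional ℝ E] [Nontrivial E]
    (μ : Measure E) [μ.IsAddHaarMeasure] (G : ℝ → ℝ) {ε : ℝ} (hε : 0 < ε) :
    ∫ x, ‖x‖ ^ (-(Module.finrank ℝ E : ℝ)) * G (ε * Real.log ‖x‖) ∂μ =
      (Module.finrank ℝ E * μ.real (ball 0 1) * ε⁻¹) * ∫ s, G s := by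
  rw [integral_fun_norm_addHaar μ
    (fun r : ℝ => r ^ (-(Module.finrank ℝ E : ℝ)) * G (ε * Real.log r))]
  have hd : 1 ≤ Module.finrank ℝ E := Module.finrank_pos
  generalize Module.finrank ℝ E = d at hd ⊢
  have key : ∫ r in Set.Ioi (0 : ℝ), r ^ (d - 1) • (r ^ (-(d : ℝ)) * G (ε * Real.log r)) =
      ∫ t, G (ε * t) := by
    rw [← Real.range_exp, ← Set.image_univ,
      integral_image_eq_integral_abs_deriv_smul MeasurableSet.univ
        (fun t _ => (Real.hasDerivAt_exp t).hasDerivWithinAt) Real.exp_injective.injOn,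
      setIntegral_univ]
    congr 1
    ext t
    have h : Real.exp t * (Real.exp t ^ (d - 1) * Real.exp t ^ (-(d : ℝ))) = 1 := by
      rw [← mul_assoc, mul_pow_sub_one (by lia), Real.rpow_neg (Real.exp_pos t).le,
        Real.rpow_natCast, mul_inv_cancel₀ (by positivity)]
    rw [abs_of_pos (Real.exp_pos t), Real.log_exp, smul_eq_mul, smul_eq_mul]
    linear_combination G (ε * t) * h
  rw [key, Measure.integral_comp_mul_left, abs_of_pos (inv_pos.2 hε)]
  simp only [nsmul_eq_mul, smul_eq_mul]
  ring

variable {E : Type*} [NormedAddCommGroup E]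

/-- The radial function `x ↦ ‖x‖ ^ (-a) * ψ (ε * log ‖x‖)`, with the power written as an
exponential. -/
noncomputable def logRadial (a ε : ℝ) (ψ : ℝ → ℝ) (x : E) : ℝ :=
  Real.exp (-a * Real.log ‖x‖) * ψ (ε * Real.log ‖x‖)

variable {a ε b c : ℝ} {ψ : ℝ → ℝ}

theorem norm_mem_Icc_of_logRadial_ne_zero (hε : 0 < ε) (hb : b < 0)
    (hψ : Function.support ψ ⊆ Set.Icc c b) {x : E} (hx : logRadial a ε ψ x ≠ 0) :
    ‖x‖ ∈ Set.Icc (Real.exp (c / ε)) (Real.exp (b / ε)) := by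
  have h := hψ (right_ne_zero_of_mul hx)
  have hx0 : 0 < ‖x‖ := by
    rw [norm_pos_iff]
    rintro rfl
    simp only [norm_zero, Real.log_zero, mul_zero, Set.mem_Icc] at h
    linarith [h.2]
  rw [Set.mem_Icc, ← Real.le_log_iff_exp_le hx0, ← Real.log_le_iff_le_exp hx0, div_le_iff₀' hε,
    le_div_iff₀' hε]
  exact h

theorem logRadial_eventuallyEq_zero (hε : 0 < ε) (hb : b < 0)
    (hψ : Function.support ψ ⊆ Set.Icc c b) :
    (logRadial a ε ψ : E → ℝ) =ᶠ[nhds 0] fun _ => 0 := by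
  filter_upwards [ball_mem_nhds (0 : E) (Real.exp_pos (c / ε))] with x hx
  by_contra h
  rw [mem_ball_zero_iff] at hx
  exact hx.not_ge (norm_mem_Icc_of_logRadial_ne_zero hε hb hψ h).1

theorem tsupport_logRadial_subset (hε : 0 < ε) (hb : b < 0)
    (hψ : Function.support ψ ⊆ Set.Icc c b) :
    tsupport (logRadial a ε ψ : E → ℝ) ⊆ closedBall 0 (Real.exp (b / ε)) :=
  closure_minimal (fun _ hx => mem_closedBall_zero_iff.2
    (norm_mem_Icc_of_logRadial_ne_zero hε hb hψ hx).2) isClosed_closedBall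

theorem exp_log_norm_mul_rpow {d p u : ℝ} (hu : 0 ≤ u) {x : E} (hx : x ≠ 0)
    (hd : (a + 1) * p = d) :
    (Real.exp (-(a + 1) * Real.log ‖x‖) * u) ^ p = ‖x‖ ^ (-d) * u ^ p := by
  rw [Real.mul_rpow (Real.exp_pos _).le hu, ← Real.exp_mul,
    Real.rpow_def_of_pos (norm_pos_iff.2 hx), ← hd]
  ring_nf

theorem abs_logRadial_rpow_mul {d p : ℝ} (hd : (a + 1) * p = d) {x : E} (hx : x ≠ 0) :
    |logRadial a ε ψ x| ^ p * ‖x‖ ^ (-p) = ‖x‖ ^ (-d) * |ψ (ε * Real.log ‖x‖)| ^ p := by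
  have hn : 0 < ‖x‖ := norm_pos_iff.2 hx
  rw [← exp_log_norm_mul_rpow (abs_nonneg _) hx hd, Real.rpow_neg hn.le, ← Real.inv_rpow hn.le,
    ← Real.mul_rpow (abs_nonneg _) (by positivity), logRadial, abs_mul,
    abs_of_pos (Real.exp_pos _), neg_add, add_mul, Real.exp_add, neg_one_mul,
    Real.exp_neg (Real.log ‖x‖), Real.exp_log hn]
  ring_nf

variable [InnerProductSpace ℝ E]

theorem contDiff_logRadial (hε : 0 < ε) (hb : b < 0)
    (hψ : Function.support ψ ⊆ Set.Icc c b) (hs : ContDiff ℝ (⊤ : ℕ∞) ψ) :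
    ContDiff ℝ (⊤ : ℕ∞) (logRadial a ε ψ : E → ℝ) := by
  rw [contDiff_iff_contDiffAt]
  intro x
  rcases eq_or_ne x 0 with rfl | hx
  · exact contDiffAt_const.congr_of_eventuallyEq (logRadial_eventuallyEq_zero hε hb hψ)
  · have hl : ContDiffAt ℝ (⊤ : ℕ∞) (fun x : E => Real.log ‖x‖) x :=
      (contDiffAt_norm ℝ hx).log (norm_ne_zero_iff.2 hx)
    exact (contDiffAt_const.mul hl).exp.mul
      (hs.contDiffAt.comp x (contDiffAt_const.mul hl))

theorem norm_fderiv_logRadial [Nontrivial E] (hs : Differentiable ℝ ψ) {x : E} (hx : x ≠ 0) :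
    ‖fderiv ℝ (logRadial a ε ψ) x‖ = Real.exp (-(a + 1) * Real.log ‖x‖) *
      |-a * ψ (ε * Real.log ‖x‖) + ε * deriv ψ (ε * Real.log ‖x‖)| := by
  have hn : 0 < ‖x‖ := norm_pos_iff.2 hx
  have hd : DifferentiableAt ℝ (fun y : E => ‖y‖) x := differentiableAt_id.norm ℝ hx
  have hg (t : ℝ) : HasDerivAt (fun t => Real.exp (-a * t) * ψ (ε * t))
      (Real.exp (-a * t) * (-a * ψ (ε * t) + ε * deriv ψ (ε * t))) t := by
    have h1 := ((hasDerivAt_id t).const_mul (-a)).exp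
    have h2 := (hs (ε * t)).hasDerivAt.comp t ((hasDerivAt_id t).const_mul ε)
    refine (h1.mul h2).congr_deriv ?_
    simp only [Function.comp_apply, id, mul_one]
    ring
  have h := (hg (Real.log ‖x‖)).comp_hasFDerivAt x (hd.hasFDerivAt.log hn.ne')
  have h' : HasFDerivAt (logRadial a ε ψ) _ x := h
  rw [h'.fderiv, norm_smul, norm_smul, norm_fderiv_norm hd, norm_mul, Real.norm_eq_abs,
    Real.norm_eq_abs, Real.norm_eq_abs, abs_of_pos (Real.exp_pos _), abs_of_pos (inv_pos.2 hn),
    neg_add, add_mul, Real.exp_add, neg_one_mul, Real.exp_neg (Real.log ‖x‖), Real.exp_log hn]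
  ring

theorem norm_fderiv_logRadial_rpow [Nontrivial E] (hs : Differentiable ℝ ψ) {d p : ℝ}
    (hd : (a + 1) * p = d) {x : E} (hx : x ≠ 0) :
    ‖fderiv ℝ (logRadial a ε ψ) x‖ ^ p = ‖x‖ ^ (-d) *
      |-a * ψ (ε * Real.log ‖x‖) + ε * deriv ψ (ε * Real.log ‖x‖)| ^ p := by
  rw [norm_fderiv_logRadial hs hx, exp_log_norm_mul_rpow (abs_nonneg _) hx hd]

end LogRadial

/-- The gradient energy of the logarithmic profile depends continuously on the scale. -/
theorem continuous_integral_abs_add_mul_deriv_rpow {ψ : ℝ → ℝ} (hs : ContDiff ℝ (⊤ : ℕ∞) ψ)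
    (hc : HasCompactSupport ψ) (a : ℝ) {p : ℝ} (hp : 0 < p) :
    Continuous fun ε : ℝ => ∫ s, |-a * ψ s + ε * deriv ψ s| ^ p := by
  have hdc : Continuous (deriv ψ) := hs.continuous_deriv (by simp)
  have hψc := hs.continuous
  rw [← continuousOn_univ]
  refine continuousOn_integral_of_compact_support (k := tsupport ψ) hc ?_ ?_
  · refine Continuous.continuousOn (Continuous.rpow_const ?_ fun _ => Or.inr hp.le)
    fun_prop
  · intro ε s _ hs
    have h : deriv ψ s = 0 :=
      Function.notMem_support.1 fun h => hs (support_deriv_subset h)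
    simp [image_eq_zero_of_notMem_tsupport hs, h, hp.ne']

/-- **Sharpness of the Hardy constant** on a ball: for every `C < (p/(n-p))^p` there is a
nonzero `φ ∈ C_c^∞(B(0,R))` violating the Hardy inequality with constant `C`. -/
theorem hardy_constant_sharp (n : ℕ) (hn : 3 ≤ n) (p R C : ℝ)
    (hp : 1 < p) (hpn : p < n) (hR : 0 < R) (hC : C < (p / ((n : ℝ) - p)) ^ p) :
    ∃ φ : EuclideanSpace ℝ (Fin n) → ℝ, ContDiff ℝ (⊤ : ℕ∞) φ ∧ HasCompactSupport φ ∧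
      tsupport φ ⊆ ball (0 : EuclideanSpace ℝ (Fin n)) R ∧ φ ≠ 0 ∧
      C * ∫ x in ball (0 : EuclideanSpace ℝ (Fin n)) R, ‖fderiv ℝ φ x‖ ^ p <
        ∫ x in ball (0 : EuclideanSpace ℝ (Fin n)) R, |φ x| ^ p * ‖x‖ ^ (-p) := by
  have hp0 : 0 < p := by linarith
  have hnp : 0 < (n : ℝ) - p := by linarith
  have : Nonempty (Fin n) := ⟨⟨0, by lia⟩⟩
  set a : ℝ := (n - p) / p with ha
  have ha0 : 0 < a := by positivity
  have hap : (a + 1) * p = n := by rw [ha]; field_simp; ring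
  have hCa : C * a ^ p < 1 := by
    rw [← inv_div, ← ha, Real.inv_rpow ha0.le] at hC
    calc C * a ^ p < (a ^ p)⁻¹ * a ^ p := by gcongr
      _ = 1 := inv_mul_cancel₀ (by positivity)
  let ψ : ContDiffBump (-3 / 2 : ℝ) := ⟨1 / 4, 1 / 2, by norm_num, by norm_num⟩
  have hψs : ContDiff ℝ (⊤ : ℕ∞) ψ := ψ.contDiff
  have hψsupp : Function.support ψ ⊆ Set.Icc (-2) (-1) := by
    rw [ψ.support_eq, Real.ball_eq_Ioo]
    refine Set.Ioo_subset_Icc_self.trans (Set.Icc_subset_Icc ?_ ?_) <;> norm_num [ψ]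
  set I : ℝ := ∫ s, |ψ s| ^ p
  have hI : 0 < I := by
    refine Continuous.integral_pos_of_hasCompactSupport_nonneg_nonzero (x := -3 / 2)
      (hψs.continuous.abs.rpow_const fun _ => Or.inr hp0.le)
      (ψ.hasCompactSupport.comp_left (g := fun t => |t| ^ p) (by simp [hp0.ne']))
      (fun _ => by positivity) ?_
    rw [ψ.one_of_mem_closedBall (mem_closedBall_self (by norm_num))]
    simp
  have hlim : ∀ᶠ ε in nhds (0 : ℝ), C * ∫ s, |-a * ψ s + ε * deriv ψ s| ^ p < I := by
    refine ((continuous_integral_abs_add_mul_deriv_rpow hψs ψ.hasCompactSupport a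
      hp0).const_mul C).continuousAt.eventually_lt continuousAt_const ?_
    have h0 : ∫ s, |-a * ψ s + 0 * deriv ψ s| ^ p = a ^ p * I := by
      rw [← integral_const_mul]
      congr 1
      ext s
      rw [zero_mul, add_zero, abs_mul, abs_neg, abs_of_pos ha0,
        Real.mul_rpow ha0.le (abs_nonneg _)]
    rw [h0, ← mul_assoc]
    exact mul_lt_of_lt_one_left hI hCa
  have hsmall : ∀ᶠ ε in nhdsWithin (0 : ℝ) (Set.Ioi 0), Real.exp (-1 / ε) < R := by
    have : Filter.Tendsto (fun ε : ℝ => Real.exp (-1 / ε)) (nhdsWithin 0 (Set.Ioi 0))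
        (nhds 0) := by
      simp_rw [neg_div, one_div]
      exact Real.tendsto_exp_atBot.comp
        (Filter.tendsto_neg_atTop_atBot.comp tendsto_inv_nhdsGT_zero)
    exact this.eventually_lt_const hR
  obtain ⟨ε, ⟨hε1, hε2⟩, hε⟩ :=
    ((hlim.filter_mono nhdsWithin_le_nhds).and hsmall |>.and self_mem_nhdsWithin).exists
  have hε : 0 < ε := hε
  set φ : EuclideanSpace ℝ (Fin n) → ℝ := logRadial a ε ψ
  have hts : tsupport φ ⊆ closedBall 0 (Real.exp (-1 / ε)) :=
    tsupport_logRadial_subset hε (by norm_num) hψsupp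
  have hball : tsupport φ ⊆ ball 0 R := hts.trans (closedBall_subset_ball hε2)
  have hc : HasCompactSupport φ :=
    (isCompact_closedBall _ _).of_isClosed_subset (isClosed_tsupport _) hts
  have hfin : Module.finrank ℝ (EuclideanSpace ℝ (Fin n)) = n := by simp
  have hκ : 0 < (n : ℝ) * volume.real (ball (0 : EuclideanSpace ℝ (Fin n)) 1) * ε⁻¹ := by
    have : 0 < volume.real (ball (0 : EuclideanSpace ℝ (Fin n)) 1) :=

      ENNReal.toReal_pos (measure_ball_pos _ _ one_pos).ne' measure_ball_lt_top.ne
    have : (0 : ℝ) < n := by linarith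
    positivity
  have hne : ∀ᵐ x : EuclideanSpace ℝ (Fin n), x ≠ 0 := by
    simp [ae_iff]
  have hgrad : ∫ x in ball (0 : EuclideanSpace ℝ (Fin n)) R, ‖fderiv ℝ φ x‖ ^ p =
      (n * volume.real (ball (0 : EuclideanSpace ℝ (Fin n)) 1) * ε⁻¹) *
        ∫ s, |-a * ψ s + ε * deriv ψ s| ^ p := by
    rw [setIntegral_eq_integral_of_forall_compl_eq_zero]
    · have h := integral_norm_rpow_neg_finrank_mul_comp_log
        (volume : Measure (EuclideanSpace ℝ (Fin n)))
        (fun s => |-a * ψ s + ε * deriv ψ s| ^ p) hε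
      rw [hfin] at h
      rw [← h]
      refine integral_congr_ae (hne.mono fun x hx => ?_)
      exact norm_fderiv_logRadial_rpow (hψs.differentiable (by simp)) hap hx
    · intro x hx
      have h0 : fderiv ℝ φ x = 0 := Function.notMem_support.1 fun h =>
        hx (hball (support_fderiv_subset ℝ h))
      simp [h0, hp0.ne']
  have hmass : ∫ x in ball (0 : EuclideanSpace ℝ (Fin n)) R, |φ x| ^ p * ‖x‖ ^ (-p) =
      (n * volume.real (ball (0 : EuclideanSpace ℝ (Fin n)) 1) * ε⁻¹) * I := by
    rw [setIntegral_eq_integral_of_forall_compl_eq_zero]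
    · have h := integral_norm_rpow_neg_finrank_mul_comp_log
        (volume : Measure (EuclideanSpace ℝ (Fin n))) (fun s => |ψ s| ^ p) hε
      rw [hfin] at h
      rw [← h]
      exact integral_congr_ae (hne.mono fun x hx => abs_logRadial_rpow_mul hap hx)
    · intro x hx
      have h0 : φ x = 0 := image_eq_zero_of_notMem_tsupport fun h => hx (hball h)
      simp [h0, hp0.ne']
  refine ⟨φ, contDiff_logRadial hε (by norm_num) hψsupp hψs, hc, hball, ?_, ?_⟩
  · intro h
    rw [h] at hmass
    simp only [Pi.zero_apply, abs_zero, Real.zero_rpow hp0.ne', zero_mul, integral_zero] at hmass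
    exact (mul_pos hκ hI).ne hmass
  · rw [hgrad, hmass, mul_left_comm]
    exact mul_lt_mul_of_pos_left hε1 hκ
end

section
/- Let n ≥ 3, 1 < p < ∞, and let Ω ⊆ ℝⁿ be a bounded connected open set. If ℝⁿ∖Ω is uniformly p-fat with constants c₀ and r₀, then there exist q with 1 < q < p and a constant c₁ > 0, both depending only on n, p and c₀, such that ℝⁿ∖Ω is uniformly q-fat with constants c₁ and r₀. -/
open MeasureTheory Metric
open scoped NNReal ENNReal

/-- The variational `p`-capacity of the condenser `(K, U)`: the infimum of `∫_U |∇φ|^p`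
over Lipschitz functions `φ` with compact support contained in `U` with `φ ≥ 1` on `K`. -/
noncomputable def pCap (n : ℕ) (p : ℝ) (K U : Set (EuclideanSpace ℝ (Fin n))) : ℝ :=
  sInf { c : ℝ | ∃ φ : EuclideanSpace ℝ (Fin n) → ℝ, (∃ L : ℝ≥0, LipschitzWith L φ) ∧
    HasCompactSupport φ ∧ tsupport φ ⊆ U ∧ (∀ x ∈ K, 1 ≤ φ x) ∧
    c = ∫ x in U, ‖fderiv ℝ φ x‖ ^ p }

/-- A closed set `E ⊆ ℝⁿ` is uniformly `p`-fat with constants `c₀, r₀ > 0` if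
`cap_p(E ∩ B̄(x,r), B(x,2r)) ≥ c₀ · cap_p(B̄(x,r), B(x,2r))` for all `x ∈ ∂E`, `0 < r ≤ r₀`. -/
def UniformlyFat (n : ℕ) (p c₀ r₀ : ℝ) (E : Set (EuclideanSpace ℝ (Fin n))) : Prop :=
  ∀ x ∈ frontier E, ∀ r : ℝ, 0 < r → r ≤ r₀ →
    c₀ * pCap n p (closedBall x r) (ball x (2 * r)) ≤
      pCap n p (E ∩ closedBall x r) (ball x (2 * r))

lemma enorm_sub_rpow_le_lintegral_deriv {f : ℝ → ℝ} {L : ℝ≥0} (hf : LipschitzWith L f)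
    {s : ℝ} (hs : 1 ≤ s) :
    ‖f 1 - f 0‖ₑ ^ s ≤ ∫⁻ t in Set.Ioc (0 : ℝ) 1, ‖deriv f t‖ₑ ^ s := by
  have hac : AbsolutelyContinuousOnInterval f 0 1 :=
    (hf.lipschitzOnWith (s := Set.uIcc 0 1)).absolutelyContinuousOnInterval
  have h1 : ‖f 1 - f 0‖ₑ ≤ ∫⁻ t in Set.Ioc (0 : ℝ) 1, ‖deriv f t‖ₑ := by
    rw [← hac.integral_deriv_eq_sub, intervalIntegral.integral_of_le zero_le_one]
    exact enorm_integral_le_lintegral_enorm _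
  have hprob : IsProbabilityMeasure (volume.restrict (Set.Ioc (0 : ℝ) 1)) := ⟨by simp⟩
  have h2 := eLpNorm'_le_eLpNorm'_of_exponent_le one_pos hs (volume.restrict (Set.Ioc (0 : ℝ) 1))
    (measurable_deriv f).aestronglyMeasurable
  simp only [eLpNorm', ENNReal.rpow_one, div_one] at h2
  calc _ ≤ ((∫⁻ t in Set.Ioc (0 : ℝ) 1, ‖deriv f t‖ₑ ^ s) ^ (1 / s)) ^ s :=
        ENNReal.rpow_le_rpow (h1.trans h2) (by linarith)
    _ = _ := by
        rw [← ENNReal.rpow_mul, one_div_mul_cancel (by linarith), ENNReal.rpow_one]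

section Analysis

variable {E : Type*} [NormedAddCommGroup E] [NormedSpace ℝ E] [FiniteDimensional ℝ E]
  [MeasurableSpace E] [BorelSpace E] (μ : Measure E) [μ.IsAddHaarMeasure]

lemma measure_closedBall_mul_radius (x : E) {t : ℝ} (ht : 0 < t) (ρ : ℝ) :
    μ (closedBall x (t * ρ)) =
      ENNReal.ofReal (t ^ Module.finrank ℝ E) * μ (closedBall x ρ) := by
  rw [Measure.addHaar_closedBall_mul_of_pos μ x ht, Measure.addHaar_closedBall_center μ x ρ]

lemma setLIntegral_closedBall_comp_segment {G : E → ℝ≥0∞} (hG : Measurable G) (x : E) {ρ t : ℝ}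
    (ht : 0 < t) :
    ∫⁻ y in closedBall x ρ, G (x + t • (y - x)) ∂μ =
      (ENNReal.ofReal (t ^ Module.finrank ℝ E))⁻¹ * ∫⁻ y in closedBall x (t * ρ), G y ∂μ := by
  have hpre : (fun y => x + t • (y - x)) ⁻¹' closedBall x (t * ρ) = closedBall x ρ := by
    ext y
    simp only [Set.mem_preimage, mem_closedBall, dist_eq_norm, add_sub_cancel_left, norm_smul,
      Real.norm_eq_abs, abs_of_pos ht]
    exact mul_le_mul_iff_right₀ ht
  have hmeas : Measurable (fun y => x + t • (y - x)) := by fun_prop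
  have hmap : Measure.map (fun y => x + t • (y - x)) μ =
      (ENNReal.ofReal (t ^ Module.finrank ℝ E))⁻¹ • μ := by
    have h1 : (fun y => x + t • (y - x)) =
        (fun y => x + y) ∘ (fun y => t • y) ∘ (fun y => y - x) := by
      ext y; simp
    rw [h1, ← Measure.map_map (by fun_prop) (by fun_prop),
      ← Measure.map_map (by fun_prop) (by fun_prop),
      map_sub_right_eq_self, Measure.map_addHaar_smul μ ht.ne', Measure.map_smul,
      map_add_left_eq_self,
      abs_of_pos (by positivity), ENNReal.ofReal_inv_of_pos (by positivity)]
  rw [← hpre, ← setLIntegral_map measurableSet_closedBall hG hmeas, hmap]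
  simp [Measure.restrict_smul, lintegral_smul_measure]

theorem lintegral_enorm_sub_rpow_le {u : E → ℝ} {L : ℝ≥0} (hu : LipschitzWith L u) {s : ℝ}
    (hs : 1 ≤ s) {x : E} {ρ : ℝ} (hρ : 0 < ρ) {K : ℝ≥0∞}
    (hK : ∀ t, 0 < t → t ≤ ρ →
      ∫⁻ y in closedBall x t, ‖fderiv ℝ u y‖ₑ ^ s ∂μ ≤ K * μ (closedBall x t)) :
    ∫⁻ y in closedBall x ρ, ‖u y - u x‖ₑ ^ s ∂μ ≤
      ENNReal.ofReal ρ ^ s * (K * μ (closedBall x ρ)) := by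
  classical
  set D : Set E := {y | DifferentiableAt ℝ u y} with hD
  have hDm : MeasurableSet D := measurableSet_of_differentiableAt ℝ u
  set G : E → ℝ≥0∞ := D.piecewise (fun y => ‖fderiv ℝ u y‖ₑ ^ s) (fun _ => ⊤) with hGdef
  have hGm : Measurable G :=
    Measurable.piecewise hDm ((measurable_fderiv ℝ u).enorm.pow_const s) measurable_const
  have hGae : G =ᵐ[μ] fun y => ‖fderiv ℝ u y‖ₑ ^ s := by
    filter_upwards [hu.ae_differentiableAt (μ := μ)] with y hy
    exact Set.piecewise_eq_of_mem _ _ _ hy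
  have hpt : ∀ y ∈ closedBall x ρ, ‖u y - u x‖ₑ ^ s ≤
      ENNReal.ofReal ρ ^ s * ∫⁻ t in Set.Ioc (0 : ℝ) 1, G (x + t • (y - x)) := by
    intro y hy
    have hyρ : ‖y - x‖ₑ ≤ ENNReal.ofReal ρ := by
      rw [← ofReal_norm, ← dist_eq_norm]
      exact ENNReal.ofReal_le_ofReal hy
    set f : ℝ → ℝ := fun t => u (x + t • (y - x)) with hf
    have hlin : LipschitzWith ‖y - x‖₊ (fun t : ℝ => x + t • (y - x)) := by
      refine LipschitzWith.of_dist_le_mul fun a b => ?_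
      simp [dist_eq_norm, ← sub_smul, norm_smul, mul_comm]
    have hfL : LipschitzWith (L * ‖y - x‖₊) f := hu.comp hlin
    have h1 := enorm_sub_rpow_le_lintegral_deriv hfL hs
    have e1 : f 1 = u y := by simp [hf]
    have e0 : f 0 = u x := by simp [hf]
    rw [e1, e0] at h1
    refine h1.trans ?_
    have hGt : Measurable fun t : ℝ => G (x + t • (y - x)) := hGm.comp (by fun_prop)
    rw [← lintegral_const_mul _ hGt]
    refine lintegral_mono fun t => ?_
    by_cases hd : x + t • (y - x) ∈ D
    · have hGd : G (x + t • (y - x)) = ‖fderiv ℝ u (x + t • (y - x))‖ₑ ^ s :=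
        Set.piecewise_eq_of_mem _ _ _ hd
      have hder : HasDerivAt f (fderiv ℝ u (x + t • (y - x)) (y - x)) t := by
        have h2 : HasDerivAt (fun t : ℝ => x + t • (y - x)) (y - x) t := by
          simpa using ((hasDerivAt_id t).smul_const (y - x)).const_add x
        exact HasFDerivAt.comp_hasDerivAt t (DifferentiableAt.hasFDerivAt hd) h2
      rw [hGd, hder.deriv, ← ENNReal.mul_rpow_of_nonneg _ _ (by linarith)]
      refine ENNReal.rpow_le_rpow ?_ (by linarith)
      calc _ ≤ ‖fderiv ℝ u (x + t • (y - x))‖ₑ * ‖y - x‖ₑ := ContinuousLinearMap.le_opENorm _ _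
        _ ≤ _ := by rw [mul_comm]; gcongr
    · have hGd : G (x + t • (y - x)) = ⊤ := Set.piecewise_eq_of_notMem _ _ _ hd
      rw [hGd, ENNReal.mul_top]
      · exact le_top
      · simp [ENNReal.rpow_eq_zero_iff, hρ]
  have hslice : ∀ t ∈ Set.Ioc (0 : ℝ) 1,
      ∫⁻ y in closedBall x ρ, G (x + t • (y - x)) ∂μ ≤ K * μ (closedBall x ρ) := by
    intro t ht
    have hp : 0 < t ^ Module.finrank ℝ E := pow_pos ht.1 _
    rw [setLIntegral_closedBall_comp_segment μ hGm x ht.1,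
      lintegral_congr_ae (ae_restrict_of_ae hGae)]
    calc _ ≤ (ENNReal.ofReal (t ^ Module.finrank ℝ E))⁻¹ * (K * μ (closedBall x (t * ρ))) := by
          gcongr
          exact hK _ (mul_pos ht.1 hρ) (mul_le_of_le_one_left hρ.le ht.2)
      _ = K * μ (closedBall x ρ) := by
          rw [measure_closedBall_mul_radius μ x ht.1, mul_left_comm K,
            ← mul_assoc, ENNReal.inv_mul_cancel (by simpa using hp) ENNReal.ofReal_ne_top, one_mul]
  have hjm : Measurable (fun z : E × ℝ => G (x + z.2 • (z.1 - x))) := hGm.comp (by fun_prop)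
  calc _ ≤ ∫⁻ y in closedBall x ρ,
        ENNReal.ofReal ρ ^ s * ∫⁻ t in Set.Ioc (0 : ℝ) 1, G (x + t • (y - x)) ∂volume ∂μ :=
        setLIntegral_mono' measurableSet_closedBall hpt
    _ = ENNReal.ofReal ρ ^ s * ∫⁻ t in Set.Ioc (0 : ℝ) 1,
        ∫⁻ y in closedBall x ρ, G (x + t • (y - x)) ∂μ := by
        rw [lintegral_const_mul _
          (hjm.lintegral_prod_right' (ν := volume.restrict (Set.Ioc (0:ℝ) 1))),
          lintegral_lintegral_swap hjm.aemeasurable]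
    _ ≤ ENNReal.ofReal ρ ^ s * ∫⁻ _ in Set.Ioc (0 : ℝ) 1, K * μ (closedBall x ρ) := by
        refine mul_le_mul_right ?_ _
        exact setLIntegral_mono' measurableSet_Ioc hslice
    _ = _ := by simp

/-- The weak-type estimate behind the Hardy–Littlewood maximal inequality. -/
theorem mul_measure_le_of_forall_closedBall (ν : Measure E) {S U : Set E} {R : ℝ} {c : ℝ≥0∞}
    (h : ∀ y ∈ S, ∃ t, 0 < t ∧ t ≤ R ∧ closedBall y t ⊆ U ∧
      c * μ (closedBall y t) ≤ ν (closedBall y t)) :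
    c * μ S ≤ 5 ^ Module.finrank ℝ E * ν U := by
  choose! t ht0 htR htU hc using h
  obtain ⟨T, hTS, hdisj, hcov⟩ :=
    Vitali.exists_disjoint_subfamily_covering_enlargement_closedBall S id t R htR 5 (by norm_num)
  have hTc : T.Countable := by
    refine hdisj.countable_of_nonempty_interior fun a ha => ?_
    exact ⟨a, ball_subset_interior_closedBall (mem_ball_self (ht0 a (hTS ha)))⟩
  have := hTc.to_subtype
  have hSc : S ⊆ ⋃ b ∈ T, closedBall b (5 * t b) := by
    intro y hy
    obtain ⟨b, hb, hyb⟩ := hcov y hy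
    exact Set.mem_biUnion hb (hyb (mem_closedBall_self (ht0 y hy).le))
  calc c * μ S ≤ c * ∑' b : T, μ (closedBall (b : E) (5 * t b)) := by
        gcongr
        exact (measure_mono hSc).trans (measure_biUnion_le μ hTc _)
    _ = ∑' b : T, 5 ^ Module.finrank ℝ E * (c * μ (closedBall (b : E) (t b))) := by
        rw [← ENNReal.tsum_mul_left]
        congr 1 with b
        rw [measure_closedBall_mul_radius μ _ (by norm_num : (0 : ℝ) < 5), mul_left_comm,
          ENNReal.ofReal_pow (by norm_num)]
        norm_num
    _ ≤ ∑' b : T, 5 ^ Module.finrank ℝ E * ν (closedBall (b : E) (t b)) := by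
        gcongr with b
        exact hc _ (hTS b.2)
    _ = 5 ^ Module.finrank ℝ E * ν (⋃ b ∈ T, closedBall b (t b)) := by
        rw [ENNReal.tsum_mul_left]
        exact congrArg _ (measure_biUnion hTc hdisj fun _ _ => measurableSet_closedBall).symm
    _ ≤ _ := by
        gcongr
        exact Set.iUnion₂_subset fun b hb => htU b (hTS hb)

end Analysis

section Analysis

variable {E : Type*} [NormedAddCommGroup E] [NormedSpace ℝ E] [FiniteDimensional ℝ E]
  [MeasurableSpace E] [BorelSpace E] (μ : Measure E) [μ.IsAddHaarMeasure]

theorem ae_fderiv_eq_of_eq {u v : E → ℝ} {K L : ℝ≥0} (hu : LipschitzWith K u)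
    (hv : LipschitzWith L v) : ∀ᵐ y ∂μ, u y = v y → fderiv ℝ u y = fderiv ℝ v y := by
  rcases subsingleton_or_nontrivial E with hE | hE
  · exact Filter.Eventually.of_forall fun y _ => Subsingleton.elim _ _
  obtain ⟨e, he⟩ := exists_ne (0 : E)
  set w : E → ℝ := fun y => u y - v y with hw
  set S : Set E := {y | w y = 0} ∩ ({y | DifferentiableAt ℝ u y} ∩ {y | DifferentiableAt ℝ v y})
    with hS
  have hwc : Continuous w := hu.continuous.sub hv.continuous
  have hSm : MeasurableSet S := (isClosed_eq hwc continuous_const).measurableSet.inter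
    ((measurableSet_of_differentiableAt ℝ u).inter (measurableSet_of_differentiableAt ℝ v))
  have happ : ApproximatesLinearOn (fun y => w y • e) (0 : E →L[ℝ] E) S 0 := by
    rw [ApproximatesLinearOn.eq_1]
    intro a ha b hb
    have h1 : w a = 0 := ha.1
    have h2 : w b = 0 := hb.1
    simp [h1, h2]
  have hder : ∀ y ∈ S, HasFDerivWithinAt (fun y => w y • e)
      ((fderiv ℝ u y - fderiv ℝ v y).smulRight e) S y := fun y hy =>
    ((hy.2.1.hasFDerivAt.sub hy.2.2.hasFDerivAt).smul_const e).hasFDerivWithinAt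
  have := (ae_restrict_iff' hSm).1 (happ.norm_fderiv_sub_le μ hSm _ hder)
  filter_upwards [this, hu.ae_differentiableAt (μ := μ), hv.ae_differentiableAt (μ := μ)]
    with y hy h1 h2 heq
  have h3 := hy ⟨by simp [hw, heq], h1, h2⟩
  rw [sub_zero, nonpos_iff_eq_zero, nnnorm_eq_zero] at h3
  rw [← sub_eq_zero]
  ext z
  have h4 := congrArg (fun T : E →L[ℝ] E => T z) h3
  simpa [he, sub_eq_zero] using h4

lemma ae_enorm_fderiv_le_of_lipschitzOnWith {u : E → ℝ} {K L : ℝ≥0} {S : Set E}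
    (hu : LipschitzWith L u) (hS : LipschitzOnWith K u S) :
    ∀ᵐ y ∂μ, y ∈ S → ‖fderiv ℝ u y‖ₑ ≤ K := by
  obtain ⟨w, hw, hwu⟩ := hS.extend_real
  filter_upwards [ae_fderiv_eq_of_eq μ hu hw] with y hy hyS
  rw [hy (hwu hyS)]
  exact_mod_cast norm_fderiv_le_of_lipschitz ℝ hw

omit [FiniteDimensional ℝ E] [MeasurableSpace E] [BorelSpace E] in
lemma norm_fderiv_le_add_of_forall_abs_sub_le {v φ : E → ℝ} {κ : ℝ} (hκ : 0 ≤ κ) {y : E}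
    (hφ : DifferentiableAt ℝ φ y) (h : ∀ a, |v a - v y| ≤ |φ a - φ y| + κ * ‖a - y‖) :
    ‖fderiv ℝ v y‖ ≤ ‖fderiv ℝ φ y‖ + κ := by
  refine le_of_forall_pos_le_add fun ε hε => ?_
  refine norm_fderiv_le_of_lip' ℝ (by positivity) ?_
  filter_upwards [hφ.hasFDerivAt.isLittleO.def hε] with a ha
  have h1 : |φ a - φ y| ≤ ‖fderiv ℝ φ y‖ * ‖a - y‖ + ε * ‖a - y‖ := by
    have h2 := (fderiv ℝ φ y).le_opNorm (a - y)
    have h3 := norm_add_le (φ a - φ y - fderiv ℝ φ y (a - y)) (fderiv ℝ φ y (a - y))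
    rw [sub_add_cancel, Real.norm_eq_abs] at h3
    linarith
  rw [Real.norm_eq_abs]
  linarith [h a]

/-- The maximal function of `f` at `x` is at most `K`. -/
def MaximalLE (f : E → ℝ≥0∞) (x : E) (K : ℝ≥0∞) : Prop :=
  ∀ ρ, 0 < ρ → ∫⁻ y in closedBall x ρ, f y ∂μ ≤ K * μ (closedBall x ρ)

lemma isClosed_setOf_maximalLE (f : E → ℝ≥0∞) {K : ℝ≥0∞} (hK : K ≠ ⊤) :
    IsClosed {x | MaximalLE μ f x K} := by
  refine isClosed_iff_clusterPt.2 fun x hx ρ hρ => ?_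
  have hlim : Filter.Tendsto (fun δ : ℝ => K * μ (closedBall x (ρ + 2 * δ)))
      (nhdsWithin 0 (Set.Ioi 0)) (nhds (K * μ (closedBall x ρ))) := by
    have h1 : ∀ᶠ δ in nhdsWithin (0 : ℝ) (Set.Ioi 0), K * μ (closedBall x (ρ + 2 * δ)) =
        K * (ENNReal.ofReal ((ρ + 2 * δ) ^ Module.finrank ℝ E) * μ (closedBall x 1)) := by
      filter_upwards [self_mem_nhdsWithin] with δ hδ
      rw [← measure_closedBall_mul_radius μ x (by have := Set.mem_Ioi.1 hδ; positivity), mul_one]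
    rw [Filter.tendsto_congr' h1]
    have h2 : K * μ (closedBall x ρ) =
        K * (ENNReal.ofReal ((ρ + 2 * 0) ^ Module.finrank ℝ E) * μ (closedBall x 1)) := by
      rw [mul_zero, add_zero, ← measure_closedBall_mul_radius μ x hρ, mul_one]
    rw [h2]
    refine ENNReal.Tendsto.const_mul (ENNReal.Tendsto.mul_const ?_ (Or.inr ?_)) (Or.inr hK)
    · refine (ENNReal.tendsto_ofReal ?_).mono_left nhdsWithin_le_nhds
      exact Continuous.tendsto (by fun_prop) _
    · exact measure_closedBall_lt_top.ne
  refine ge_of_tendsto hlim ?_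
  filter_upwards [self_mem_nhdsWithin] with δ hδ
  have hδ' : 0 < δ := hδ
  obtain ⟨y, hyx, hy⟩ : ∃ y ∈ ball x δ, MaximalLE μ f y K := by
    have := mem_closure_iff_clusterPt.2 hx
    obtain ⟨y, hy, hyx⟩ := Metric.mem_closure_iff.1 this δ hδ'
    exact ⟨y, by rwa [mem_ball, dist_comm], hy⟩
  have hyx' : dist y x < δ := hyx
  calc ∫⁻ z in closedBall x ρ, f z ∂μ ≤ ∫⁻ z in closedBall y (ρ + δ), f z ∂μ :=
        lintegral_mono_set (closedBall_subset_closedBall' (by rw [dist_comm]; linarith))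
    _ ≤ K * μ (closedBall y (ρ + δ)) := hy _ (by linarith)
    _ ≤ K * μ (closedBall x (ρ + 2 * δ)) := by
        gcongr
        exact closedBall_subset_closedBall' (by linarith)

lemma mul_measure_setOf_not_maximalLE_inter_closedBall_le {f : E → ℝ≥0∞} {x : E} {K c : ℝ≥0∞}
    (hf : MaximalLE μ f x K) (hc : 2 ^ Module.finrank ℝ E * K ≤ c) {ρ : ℝ} (hρ : 0 < ρ) :
    c * μ ({y | ¬ MaximalLE μ f y c} ∩ closedBall x ρ) ≤
      10 ^ Module.finrank ℝ E * K * μ (closedBall x ρ) := by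
  have h2 : ∀ t, μ (closedBall x (2 * t)) = 2 ^ Module.finrank ℝ E * μ (closedBall x t) := by
    intro t
    rw [measure_closedBall_mul_radius μ x two_pos, ENNReal.ofReal_pow (by norm_num)]
    norm_num
  have key := mul_measure_le_of_forall_closedBall μ (μ.withDensity f) (R := ρ)
    (U := closedBall x (2 * ρ)) (c := c)
    (S := {y | ¬ MaximalLE μ f y c} ∩ closedBall x ρ) ?_
  · rw [withDensity_apply _ measurableSet_closedBall] at key
    calc _ ≤ _ := key
      _ ≤ 5 ^ Module.finrank ℝ E * (K * μ (closedBall x (2 * ρ))) := by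
          gcongr
          exact hf _ (by positivity)
      _ = _ := by
          rw [h2, show (10 : ℝ≥0∞) = 5 * 2 by norm_num, mul_pow]
          ring
  · rintro y ⟨hy, hyx⟩
    simp only [MaximalLE, Set.mem_ofPred_eq, not_forall, not_le] at hy
    obtain ⟨t, ht, hlt⟩ := hy
    have hyx' : dist y x ≤ ρ := hyx
    have htρ : t ≤ ρ := by
      by_contra! hρt
      refine absurd hlt (not_lt.2 ?_)
      calc ∫⁻ z in closedBall y t, f z ∂μ ≤ ∫⁻ z in closedBall x (2 * t), f z ∂μ :=
            lintegral_mono_set (closedBall_subset_closedBall' (by linarith))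
        _ ≤ K * μ (closedBall x (2 * t)) := hf _ (by positivity)
        _ = 2 ^ Module.finrank ℝ E * K * μ (closedBall y t) := by
            rw [h2, Measure.addHaar_closedBall_center μ x, Measure.addHaar_closedBall_center μ y]
            ring
        _ ≤ c * μ (closedBall y t) := by gcongr
    refine ⟨t, ht, htρ, closedBall_subset_closedBall' (by linarith), ?_⟩
    rw [withDensity_apply _ measurableSet_closedBall]
    exact hlt.le

lemma edist_le_of_maximalLE {u : E → ℝ} {L : ℝ≥0} (hu : LipschitzWith L u) {q : ℝ} (hq : 1 ≤ q)
    {y z : E} {l : ℝ≥0} (hy : MaximalLE μ (fun y => ‖fderiv ℝ u y‖ₑ ^ q) y ((l : ℝ≥0∞) ^ q))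
    (hz : MaximalLE μ (fun y => ‖fderiv ℝ u y‖ₑ ^ q) z ((l : ℝ≥0∞) ^ q)) :
    edist (u y) (u z) ≤ (2 ^ (Module.finrank ℝ E + 1) * l : ℝ≥0) * edist y z := by
  rcases eq_or_ne y z with rfl | hyz
  · simp
  have hq0 : 0 < q := by linarith
  set s := dist y z with hs
  have hs0 : 0 < s := dist_pos.2 hyz
  set W := closedBall (midpoint ℝ y z) (s / 2) with hW
  have hWy : W ⊆ closedBall y s := closedBall_subset_closedBall' (by
    rw [dist_midpoint_left, Real.norm_eq_abs]
    norm_num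
    linarith)
  have hWz : W ⊆ closedBall z s := closedBall_subset_closedBall' (by
    rw [dist_midpoint_right, Real.norm_eq_abs]
    norm_num
    linarith)
  have hball : ∀ a, μ (closedBall a s) = 2 ^ Module.finrank ℝ E * μ W := by
    intro a
    rw [show s = 2 * (s / 2) by ring, measure_closedBall_mul_radius μ a two_pos,
      ENNReal.ofReal_pow (by norm_num), hW, Measure.addHaar_closedBall_center,
      Measure.addHaar_closedBall_center μ (midpoint ℝ y z)]
    norm_num
  have hint : ∀ a, MaximalLE μ (fun y => ‖fderiv ℝ u y‖ₑ ^ q) a ((l : ℝ≥0∞) ^ q) →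
      W ⊆ closedBall a s → ∫⁻ w in W, ‖u w - u a‖ₑ ^ q ∂μ ≤
        ENNReal.ofReal s ^ q * (l ^ q * (2 ^ Module.finrank ℝ E * μ W)) := by
    intro a ha hWa
    calc _ ≤ ∫⁻ w in closedBall a s, ‖u w - u a‖ₑ ^ q ∂μ := lintegral_mono_set hWa
      _ ≤ _ := lintegral_enorm_sub_rpow_le μ hu hq hs0 fun t ht _ => ha t ht
      _ = _ := by rw [hball]
  have hW0 : μ W ≠ 0 := (measure_closedBall_pos μ _ (by positivity)).ne'
  have hWt : μ W ≠ ⊤ := measure_closedBall_lt_top.ne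
  have hmeas : Measurable fun w => ‖u w - u y‖ₑ ^ q :=
    ((hu.continuous.measurable.sub_const _).enorm.pow_const q)
  have h2q : (2 : ℝ≥0∞) ^ (q - 1) * 2 = 2 ^ q := by
    conv_lhs => rw [← ENNReal.rpow_one 2, ← ENNReal.rpow_mul, one_mul]
    rw [← ENNReal.rpow_add _ _ (by norm_num) (by norm_num), sub_add_cancel]
  have hmain : ‖u y - u z‖ₑ ^ q * μ W ≤
      2 ^ q * (ENNReal.ofReal s ^ q * (l ^ q * 2 ^ Module.finrank ℝ E)) * μ W := by
    calc ‖u y - u z‖ₑ ^ q * μ W = ∫⁻ _ in W, ‖u y - u z‖ₑ ^ q ∂μ := by simp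
      _ ≤ ∫⁻ w in W, 2 ^ (q - 1) * (‖u w - u y‖ₑ ^ q + ‖u w - u z‖ₑ ^ q) ∂μ := by
          refine lintegral_mono fun w => ?_
          refine le_trans ?_ (ENNReal.rpow_add_le_mul_rpow_add_rpow _ _ hq)
          refine ENNReal.rpow_le_rpow ?_ hq0.le
          have := enorm_sub_le (a := u w - u z) (b := u w - u y)
          rw [sub_sub_sub_cancel_left] at this
          rwa [add_comm]
      _ = 2 ^ (q - 1) * (∫⁻ w in W, ‖u w - u y‖ₑ ^ q ∂μ + ∫⁻ w in W, ‖u w - u z‖ₑ ^ q ∂μ) := by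
          rw [lintegral_const_mul' _ _ (by simp), lintegral_add_left hmeas]
      _ ≤ 2 ^ (q - 1) * (ENNReal.ofReal s ^ q * (l ^ q * (2 ^ Module.finrank ℝ E * μ W)) +
            ENNReal.ofReal s ^ q * (l ^ q * (2 ^ Module.finrank ℝ E * μ W))) := by
          gcongr
          · exact hint y hy hWy
          · exact hint z hz hWz
      _ = _ := by
          rw [← h2q]; ring
  have hmain' := (ENNReal.mul_le_mul_iff_left hW0 hWt).1 hmain
  have h2d : (2 : ℝ≥0∞) ^ Module.finrank ℝ E ≤ (2 ^ Module.finrank ℝ E) ^ q := by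
    conv_lhs => rw [← ENNReal.rpow_one (2 ^ Module.finrank ℝ E)]
    exact ENNReal.rpow_le_rpow_of_exponent_le (one_le_pow₀ (by norm_num)) hq
  rw [edist_eq_enorm_sub, edist_dist, ← hs]
  rw [← ENNReal.rpow_le_rpow_iff hq0]
  calc _ ≤ _ := hmain'
    _ ≤ 2 ^ q * (ENNReal.ofReal s ^ q * (l ^ q * (2 ^ Module.finrank ℝ E) ^ q)) := by gcongr
    _ = _ := by
      rw [← ENNReal.mul_rpow_of_nonneg _ _ hq0.le, ← ENNReal.mul_rpow_of_nonneg _ _ hq0.le,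
        ← ENNReal.mul_rpow_of_nonneg _ _ hq0.le]
      congr 1
      push_cast
      ring

end Analysis

lemma sum_two_pow_rpow_le {p : ℝ} (hp : 0 < p) (J : Finset ℕ) :
    (∑ j ∈ J, (2 : ℝ≥0∞) ^ j) ^ p ≤ 2 ^ p * ∑ j ∈ J, ((2 : ℝ≥0∞) ^ j) ^ p := by
  rcases J.eq_empty_or_nonempty with rfl | hJ
  · simp [hp]
  set k := J.max' hJ with hk
  have h1 : ∑ j ∈ J, 2 ^ j < 2 ^ (k + 1) :=
    Nat.geomSum_lt le_rfl fun j hj => Nat.lt_succ_of_le (J.le_max' j hj)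
  have h2 : ∑ j ∈ J, (2 : ℝ≥0∞) ^ j ≤ 2 * 2 ^ k := by
    rw [← pow_succ']
    exact_mod_cast h1.le
  calc _ ≤ (2 * 2 ^ k : ℝ≥0∞) ^ p := ENNReal.rpow_le_rpow h2 hp.le
    _ = 2 ^ p * ((2 : ℝ≥0∞) ^ k) ^ p := ENNReal.mul_rpow_of_nonneg _ _ hp.le
    _ ≤ _ := by
      gcongr
      exact Finset.single_le_sum (f := fun j => ((2 : ℝ≥0∞) ^ j) ^ p) (fun _ _ => zero_le)
        (J.max'_mem hJ)

section Analysis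

variable {E : Type*} [NormedAddCommGroup E] [NormedSpace ℝ E] [FiniteDimensional ℝ E]
  [MeasurableSpace E] [BorelSpace E] (μ : Measure E) [μ.IsAddHaarMeasure]

/-- The pointwise `p`-Hardy inequality for the closed set `F`, raised to the power `p`. -/
def PointwiseHardy (p : ℝ) (C : ℝ≥0) (F : Set E) : Prop :=
  ∀ (v : E → ℝ) (L : ℝ≥0), LipschitzWith L v → (∀ y ∈ F, v y = 0) → ∀ (x : E) (K : ℝ≥0),
    MaximalLE μ (fun y => ‖fderiv ℝ v y‖ₑ ^ p) x K → ‖v x‖ₑ ^ p ≤ C * infEDist x F ^ p * K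

/-- The function `u` satisfies at every point the `q`-Hardy bound with constant `A`,
with `g` in place of the norm of its gradient. -/
def HardyBound (q : ℝ) (F : Set E) (u : E → ℝ) (g : E → ℝ≥0∞) (A : ℝ≥0) : Prop :=
  ∀ (x : E) (l : ℝ≥0), 0 < l → MaximalLE μ (fun y => g y ^ q) x ((l : ℝ≥0∞) ^ q) →
    ‖u x‖ₑ ≤ A * infEDist x F * l

variable {μ}

omit [NormedSpace ℝ E] [FiniteDimensional ℝ E] [BorelSpace E] [μ.IsAddHaarMeasure] in
lemma MaximalLE.mono {f f' : E → ℝ≥0∞} {x : E} {K K' : ℝ≥0∞} (h : MaximalLE μ f x K)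
    (hf : f' ≤ᵐ[μ] f) (hK : K ≤ K') : MaximalLE μ f' x K' := fun ρ hρ =>
  (lintegral_mono_ae (ae_restrict_of_ae hf)).trans ((h ρ hρ).trans (by gcongr))

lemma HardyBound.lipschitzOnWith {q : ℝ} (hq : 1 ≤ q) {F : Set E} {u : E → ℝ} {g : E → ℝ≥0∞}
    {A L : ℝ≥0} (h : HardyBound μ q F u g A) (hA : 2 ^ (Module.finrank ℝ E + 1) ≤ A)
    (hu : LipschitzWith L u) (hF : ∀ y ∈ F, u y = 0) (hg : ∀ᵐ y ∂μ, ‖fderiv ℝ u y‖ₑ ≤ g y)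
    {l : ℝ≥0} (hl : 0 < l) :
    LipschitzOnWith (A * l) u
      ({y | MaximalLE μ (fun y => g y ^ q) y ((l : ℝ≥0∞) ^ q)} ∪ F) := by
  have hmono : ∀ y, MaximalLE μ (fun y => g y ^ q) y ((l : ℝ≥0∞) ^ q) →
      MaximalLE μ (fun y => ‖fderiv ℝ u y‖ₑ ^ q) y ((l : ℝ≥0∞) ^ q) := fun y hy =>
    hy.mono (by filter_upwards [hg] with a ha using ENNReal.rpow_le_rpow ha (by linarith)) le_rfl
  have hGF : ∀ y z, MaximalLE μ (fun y => g y ^ q) y ((l : ℝ≥0∞) ^ q) → z ∈ F →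
      edist (u y) (u z) ≤ (A * l : ℝ≥0) * edist y z := by
    intro y z hy hz
    rw [hF z hz, edist_zero_right]
    calc _ ≤ _ := h y l hl hy
      _ ≤ A * edist y z * l := by gcongr; exact infEDist_le_edist_of_mem hz
      _ = _ := by push_cast; ring
  rintro y (hy | hy) z (hz | hz)
  · refine (edist_le_of_maximalLE μ hu hq (hmono y hy) (hmono z hz)).trans ?_
    gcongr
  · exact hGF y z hy hz
  · rw [edist_comm, edist_comm y]
    exact hGF z y hz hy
  · simp [hF y hy, hF z hz]

theorem HardyBound.contract {p q : ℝ} (hq : 1 ≤ q) (hqp : q < p) {F : Set E} {u : E → ℝ}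
    {g : E → ℝ≥0∞} {A C C' L : ℝ≥0} {N : ℕ} (hN : N ≠ 0) (hHardy : PointwiseHardy μ p C F)
    (h : HardyBound μ q F u g A) (hA : 2 ^ (Module.finrank ℝ E + 1) ≤ A)
    (hu : LipschitzWith L u) (hF : ∀ y ∈ F, u y = 0) (hg : ∀ᵐ y ∂μ, ‖fderiv ℝ u y‖ₑ ≤ g y)
    (h1 : (2 ^ (Module.finrank ℝ E + 1) * 2 ^ (Module.finrank ℝ E + N) : ℝ≥0) ^ (p - q) ≤ 2)
    (h2 : C * 2 ^ (p + 1) ≤ C' ^ p)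
    (h3 : C * 2 ^ (p + 1) * ((2 / N) ^ p * N * 10 ^ Module.finrank ℝ E) ≤ (1 / 2) ^ p) :
    HardyBound μ q F u g (C' + A / 2) := by
  classical
  intro x l hl hx
  set d := Module.finrank ℝ E with hd
  have hp0 : 0 < p := by linarith
  have hq0 : 0 < q := by linarith
  set lam : ℕ → ℝ≥0 := fun j => 2 ^ (d + j) * l with hlam
  have hlam0 : ∀ j, 0 < lam j := fun j => by positivity
  set G : ℕ → Set E := fun j => {y | MaximalLE μ (fun y => g y ^ q) y ((lam j : ℝ≥0∞) ^ q)}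
  have hGm : ∀ j, MeasurableSet (G j)ᶜ := fun j =>
    (isClosed_setOf_maximalLE μ _ (by simp [hq0.le])).measurableSet.compl
  have hxG : ∀ j, x ∈ G j := fun j => hx.mono (ae_of_all _ fun _ => le_rfl) (by
    gcongr
    exact le_mul_of_one_le_left zero_le (one_le_pow₀ one_le_two))
  have hlipA : ∀ j, LipschitzOnWith (A * lam j) u (G j ∪ F) := fun j =>
    h.lipschitzOnWith hq hA hu hF hg (hlam0 j)
  have hlipG : ∀ j, LipschitzOnWith (2 ^ (d + 1) * lam j) u (G j) := fun j y hy z hz =>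
    edist_le_of_maximalLE μ hu hq
      (hy.mono (by filter_upwards [hg] with a ha using ENNReal.rpow_le_rpow ha hq0.le) le_rfl)
      (hz.mono (by filter_upwards [hg] with a ha using ENNReal.rpow_le_rpow ha hq0.le) le_rfl)
  choose v hvL hvu using fun j => (hlipA j).extend_real
  set w : E → ℝ := fun y => (N : ℝ)⁻¹ * ∑ j ∈ Finset.range N, v j y with hw
  have hN0 : (N : ℝ) ≠ 0 := by exact_mod_cast hN
  have hwF : ∀ y ∈ F, w y = 0 := by
    intro y hy
    simp only [hw]
    rw [Finset.sum_eq_zero, mul_zero]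
    intro j _
    rw [← hvu j (Or.inr hy), hF y hy]
  have hwx : w x = u x := by
    simp only [hw]
    rw [Finset.sum_congr rfl fun j _ => (hvu j (Or.inl (hxG j))).symm]
    simp [hN0]
  obtain ⟨L', hwL⟩ : ∃ L' : ℝ≥0, LipschitzWith L' w := by
    have hs : ∀ s : Finset ℕ, ∃ M : ℝ≥0, LipschitzWith M fun y => ∑ j ∈ s, v j y := by
      intro s
      induction s using Finset.induction_on with
      | empty => exact ⟨0, by simp⟩
      | insert a s ha ih =>
        obtain ⟨M, hM⟩ := ih
        refine ⟨A * lam a + M, ?_⟩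
        simp_rw [Finset.sum_insert ha]
        exact (hvL a).add hM
    obtain ⟨M, hM⟩ := hs (Finset.range N)
    exact ⟨_, (lipschitzWith_smul (N : ℝ)⁻¹).comp hM⟩
  set B : ℝ≥0 := 2 ^ (d + 1) * (2 ^ (d + N) * l) with hB
  have hlamB : ∀ j < N, 2 ^ (d + 1) * lam j ≤ B := by
    intro j hj
    simp only [hlam, hB]
    gcongr
    exact one_le_two
  have hlamB' : ∀ j < N, lam j ≤ B := fun j hj =>
    (le_mul_of_one_le_left zero_le (one_le_pow₀ one_le_two)).trans (hlamB j hj)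
  set a : ℝ≥0∞ := ((2 * A / N : ℝ≥0) : ℝ≥0∞) with ha
  have hptw : ∀ᵐ y ∂μ, ‖fderiv ℝ w y‖ₑ ^ p ≤ 2 ^ p * ((B : ℝ≥0∞) ^ (p - q) * g y ^ q +
      a ^ p * ∑ j ∈ Finset.range N, (G j)ᶜ.indicator (fun _ => (lam j : ℝ≥0∞) ^ p) y) := by
    have hv1 : ∀ᵐ y ∂μ, ∀ j, DifferentiableAt ℝ (v j) y :=
      ae_all_iff.2 fun j => (hvL j).ae_differentiableAt
    have hv2 : ∀ᵐ y ∂μ, ∀ j, u y = v j y → fderiv ℝ u y = fderiv ℝ (v j) y :=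
      ae_all_iff.2 fun j => ae_fderiv_eq_of_eq μ hu (hvL j)
    have hv3 : ∀ᵐ y ∂μ, ∀ j, y ∈ G j → ‖fderiv ℝ u y‖ₑ ≤ (2 ^ (d + 1) * lam j : ℝ≥0) :=
      ae_all_iff.2 fun j => ae_enorm_fderiv_le_of_lipschitzOnWith μ hu (hlipG j)
    filter_upwards [hv1, hv2, hv3, hg] with y hy1 hy2 hy3 hgy
    set T : ℝ≥0∞ := min (‖fderiv ℝ u y‖ₑ) B with hT
    set J := (Finset.range N).filter fun j => y ∉ G j with hJ
    have hder : HasFDerivAt w ((N : ℝ)⁻¹ • ∑ j ∈ Finset.range N, fderiv ℝ (v j) y) y := by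
      have h4 : HasFDerivAt (fun y => ∑ j ∈ Finset.range N, v j y)
          (∑ j ∈ Finset.range N, fderiv ℝ (v j) y) y :=
        HasFDerivAt.fun_sum fun j _ => (hy1 j).hasFDerivAt
      exact h4.const_mul _
    have hj : ∀ j ∈ Finset.range N, ‖fderiv ℝ (v j) y‖ₑ ≤
        T + if y ∉ G j then ((A * lam j : ℝ≥0) : ℝ≥0∞) else 0 := by
      intro j hjN
      by_cases hyG : y ∈ G j
      · rw [if_neg (not_not.2 hyG), add_zero, ← hy2 j (hvu j (Or.inl hyG))]
        exact le_min le_rfl ((hy3 j hyG).trans (by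
          exact_mod_cast hlamB j (Finset.mem_range.1 hjN)))
      · rw [if_pos hyG]
        refine le_add_left ?_
        exact_mod_cast norm_fderiv_le_of_lipschitz ℝ (hvL j)
    have hNe : (N : ℝ≥0∞) ≠ 0 := by exact_mod_cast hN
    have hgrad : ‖fderiv ℝ w y‖ₑ ≤ T + a * ((2 ^ d * l : ℝ≥0) / 2 * ∑ j ∈ J, 2 ^ j) := by
      rw [hder.fderiv, enorm_smul]
      have hNn : ‖(N : ℝ)⁻¹‖ₑ = (N : ℝ≥0∞)⁻¹ := by
        rw [enorm_inv hN0]; simp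
      rw [hNn]
      calc _ ≤ (N : ℝ≥0∞)⁻¹ * ∑ j ∈ Finset.range N,
            (T + if y ∉ G j then ((A * lam j : ℝ≥0) : ℝ≥0∞) else 0) := by
            gcongr
            have hns : ‖∑ j ∈ Finset.range N, fderiv ℝ (v j) y‖ₑ ≤
                ∑ j ∈ Finset.range N, ‖fderiv ℝ (v j) y‖ₑ := by
              simp only [enorm_eq_nnnorm]
              exact_mod_cast nnnorm_sum_le (Finset.range N) fun j => fderiv ℝ (v j) y
            refine hns.trans ?_
            exact Finset.sum_le_sum fun j hjN => hj j hjN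
        _ = T + (N : ℝ≥0∞)⁻¹ * (A * (2 ^ d * l : ℝ≥0) * ∑ j ∈ J, 2 ^ j) := by
            rw [Finset.sum_add_distrib, ← Finset.sum_filter, mul_add, Finset.sum_const,
              Finset.card_range, nsmul_eq_mul, ← mul_assoc,
              ENNReal.inv_mul_cancel hNe (ENNReal.natCast_ne_top N), one_mul]
            congr 2
            rw [Finset.mul_sum]
            refine Finset.sum_congr rfl fun j _ => ?_
            simp only [hlam]
            push_cast
            ring
        _ = _ := by
            have : a = 2 * A * (N : ℝ≥0∞)⁻¹ := by
              rw [ha, ENNReal.coe_div (by exact_mod_cast hN), div_eq_mul_inv]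
              push_cast
              rfl
            rw [this, div_eq_mul_inv]
            have h22 : (2 : ℝ≥0∞) * 2⁻¹ = 1 := ENNReal.mul_inv_cancel (by norm_num) (by norm_num)
            congr 1
            calc _ = (2 * 2⁻¹) * ((N : ℝ≥0∞)⁻¹ * (A * (2 ^ d * l : ℝ≥0) * ∑ j ∈ J, 2 ^ j)) := by
                  rw [h22, one_mul]
              _ = _ := by ring
    have hTp : T ^ p ≤ (B : ℝ≥0∞) ^ (p - q) * g y ^ q := by
      calc T ^ p = T ^ (p - q) * T ^ q := by
            rw [← ENNReal.rpow_add_of_nonneg _ _ (by linarith) hq0.le, sub_add_cancel]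
        _ ≤ _ := mul_le_mul' (ENNReal.rpow_le_rpow (min_le_right _ _) (by linarith))
            (ENNReal.rpow_le_rpow ((min_le_left _ _).trans hgy) hq0.le)
    have hSp : (a * ((2 ^ d * l : ℝ≥0) / 2 * ∑ j ∈ J, 2 ^ j)) ^ p ≤
        a ^ p * ∑ j ∈ Finset.range N, (G j)ᶜ.indicator (fun _ => (lam j : ℝ≥0∞) ^ p) y := by
      rw [ENNReal.mul_rpow_of_nonneg _ _ hp0.le, ENNReal.mul_rpow_of_nonneg _ _ hp0.le]
      gcongr
      calc _ ≤ ((2 ^ d * l : ℝ≥0) / 2 : ℝ≥0∞) ^ p * (2 ^ p * ∑ j ∈ J, ((2 : ℝ≥0∞) ^ j) ^ p) := by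
            gcongr
            exact sum_two_pow_rpow_le hp0 J
        _ = ∑ j ∈ J, (lam j : ℝ≥0∞) ^ p := by
            rw [← mul_assoc, ← ENNReal.mul_rpow_of_nonneg _ _ hp0.le,
              ENNReal.div_mul_cancel (by norm_num) (by norm_num), Finset.mul_sum]
            refine Finset.sum_congr rfl fun j _ => ?_
            rw [← ENNReal.mul_rpow_of_nonneg _ _ hp0.le]
            simp only [hlam]
            push_cast
            ring_nf
        _ = _ := by
            rw [hJ, Finset.sum_filter]
            refine Finset.sum_congr rfl fun j _ => ?_
            simp [Set.indicator_apply]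
    calc _ ≤ (T + a * ((2 ^ d * l : ℝ≥0) / 2 * ∑ j ∈ J, 2 ^ j)) ^ p :=
          ENNReal.rpow_le_rpow hgrad hp0.le
      _ ≤ 2 ^ (p - 1) * (T ^ p + (a * ((2 ^ d * l : ℝ≥0) / 2 * ∑ j ∈ J, 2 ^ j)) ^ p) :=
          ENNReal.rpow_add_le_mul_rpow_add_rpow _ _ (hq.trans hqp.le)
      _ ≤ _ := by
          gcongr
          · norm_num
          · linarith
  have hBl : B ^ (p - q) * l ^ q ≤ 2 * l ^ p := by
    calc _ = (2 ^ (d + 1) * 2 ^ (d + N) : ℝ≥0) ^ (p - q) * (l ^ (p - q) * l ^ q) := by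
          rw [hB, ← mul_assoc, NNReal.mul_rpow, mul_assoc]
      _ ≤ 2 * l ^ p := by
          rw [← NNReal.rpow_add hl.ne', sub_add_cancel]
          gcongr
  have hBl' : (B : ℝ≥0∞) ^ (p - q) * (l : ℝ≥0∞) ^ q ≤ 2 * (l : ℝ≥0∞) ^ p := by
    rw [← ENNReal.coe_rpow_of_nonneg _ (by linarith), ← ENNReal.coe_rpow_of_nonneg _ hq0.le,
      ← ENNReal.coe_rpow_of_nonneg _ hp0.le]
    exact_mod_cast hBl
  have hbad : ∀ j < N, ∀ ρ, 0 < ρ → (lam j : ℝ≥0∞) ^ p * μ ((G j)ᶜ ∩ closedBall x ρ) ≤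
      10 ^ d * (2 * (l : ℝ≥0∞) ^ p) * μ (closedBall x ρ) := by
    intro j hj ρ hρ
    have hlj : (2 : ℝ≥0∞) ^ d * (l : ℝ≥0∞) ^ q ≤ (lam j : ℝ≥0∞) ^ q := by
      simp only [hlam]
      push_cast
      rw [ENNReal.mul_rpow_of_nonneg _ _ hq0.le]
      gcongr
      calc (2 : ℝ≥0∞) ^ d ≤ 2 ^ (d + j) := pow_le_pow_right₀ (by norm_num) (by omega)
        _ = (2 ^ (d + j)) ^ (1 : ℝ) := (ENNReal.rpow_one _).symm
        _ ≤ _ := ENNReal.rpow_le_rpow_of_exponent_le (one_le_pow₀ (by norm_num)) hq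
    have h5 := mul_measure_setOf_not_maximalLE_inter_closedBall_le μ hx hlj hρ
    calc _ = (lam j : ℝ≥0∞) ^ (p - q) *
          ((lam j : ℝ≥0∞) ^ q * μ ((G j)ᶜ ∩ closedBall x ρ)) := by
          rw [← mul_assoc, ← ENNReal.rpow_add_of_nonneg _ _ (by linarith) hq0.le, sub_add_cancel]
      _ ≤ (B : ℝ≥0∞) ^ (p - q) * (10 ^ d * (l : ℝ≥0∞) ^ q * μ (closedBall x ρ)) :=
          mul_le_mul' (ENNReal.rpow_le_rpow (by exact_mod_cast hlamB' j hj) (by linarith)) h5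
      _ = 10 ^ d * ((B : ℝ≥0∞) ^ (p - q) * (l : ℝ≥0∞) ^ q) * μ (closedBall x ρ) := by ring
      _ ≤ _ := by gcongr
  set K : ℝ≥0 := l ^ p * (2 ^ (p + 1) * (1 + (2 * A / N) ^ p * (N * 10 ^ d))) with hK
  have hKe : (K : ℝ≥0∞) = 2 ^ p * (2 * (l : ℝ≥0∞) ^ p +
      a ^ p * (N * (10 ^ d * (2 * (l : ℝ≥0∞) ^ p)))) := by
    rw [hK, ha, ← ENNReal.coe_rpow_of_nonneg _ hp0.le, ← ENNReal.coe_rpow_of_nonneg _ hp0.le,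
      show (2 : ℝ≥0∞) ^ p = ((2 ^ p : ℝ≥0) : ℝ≥0∞) by
        rw [ENNReal.coe_rpow_of_nonneg _ hp0.le]; rfl]
    norm_cast
    rw [NNReal.rpow_add two_ne_zero, NNReal.rpow_one]
    push_cast
    ring
  have hmax : MaximalLE μ (fun y => ‖fderiv ℝ w y‖ₑ ^ p) x K := by
    intro ρ hρ
    have hmi : ∀ j ∈ Finset.range N, Measurable fun y =>
        (G j)ᶜ.indicator (fun _ => (lam j : ℝ≥0∞) ^ p) y := fun j _ =>
      measurable_const.indicator (hGm j)
    calc _ ≤ ∫⁻ y in closedBall x ρ, 2 ^ p * ((B : ℝ≥0∞) ^ (p - q) * g y ^ q +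
          a ^ p * ∑ j ∈ Finset.range N,
            (G j)ᶜ.indicator (fun _ => (lam j : ℝ≥0∞) ^ p) y) ∂μ :=
          lintegral_mono_ae (ae_restrict_of_ae hptw)
      _ = 2 ^ p * ((B : ℝ≥0∞) ^ (p - q) * ∫⁻ y in closedBall x ρ, g y ^ q ∂μ +
          a ^ p * ∑ j ∈ Finset.range N,
            (lam j : ℝ≥0∞) ^ p * μ ((G j)ᶜ ∩ closedBall x ρ)) := by
          rw [lintegral_const_mul' _ _ (by simp),
            lintegral_add_right _ ((Finset.measurable_fun_sum _ hmi).const_mul _),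
            lintegral_const_mul' _ _ (by simp [hqp.le]),
            lintegral_const_mul _ (Finset.measurable_fun_sum _ hmi),
            lintegral_finsetSum _ hmi]
          congr 3
          refine Finset.sum_congr rfl fun j _ => ?_
          rw [lintegral_indicator (hGm j), setLIntegral_const, Measure.restrict_apply (hGm j)]
      _ ≤ 2 ^ p * ((B : ℝ≥0∞) ^ (p - q) * ((l : ℝ≥0∞) ^ q * μ (closedBall x ρ)) +
          a ^ p * ∑ j ∈ Finset.range N,
            10 ^ d * (2 * (l : ℝ≥0∞) ^ p) * μ (closedBall x ρ)) := by
          refine mul_le_mul' le_rfl (add_le_add (mul_le_mul' le_rfl (hx ρ hρ))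
            (mul_le_mul' le_rfl (Finset.sum_le_sum fun j hj => ?_)))
          exact hbad j (Finset.mem_range.1 hj) ρ hρ
      _ ≤ 2 ^ p * (2 * (l : ℝ≥0∞) ^ p * μ (closedBall x ρ) +
          a ^ p * (N * (10 ^ d * (2 * (l : ℝ≥0∞) ^ p) * μ (closedBall x ρ)))) := by
          rw [← mul_assoc ((B : ℝ≥0∞) ^ (p - q)), Finset.sum_const, Finset.card_range,
            nsmul_eq_mul]
          gcongr
      _ = _ := by
          rw [hKe]
          ring
  have hfin := hHardy w L' hwL hwF x K hmax
  rw [hwx] at hfin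
  have hCK : C * K ≤ ((C' + A / 2) * l) ^ p := by
    calc C * K = (C * 2 ^ (p + 1) + C * 2 ^ (p + 1) * ((2 / N) ^ p * N * 10 ^ d) * A ^ p) *
          l ^ p := by
          rw [hK, mul_div_right_comm, NNReal.mul_rpow]
          ring
      _ ≤ (C' ^ p + (1 / 2) ^ p * A ^ p) * l ^ p := by gcongr
      _ = (C' ^ p + (A / 2) ^ p) * l ^ p := by
          rw [← NNReal.mul_rpow, one_div_mul_eq_div]
      _ ≤ (C' + A / 2) ^ p * l ^ p := by
          gcongr
          exact NNReal.add_rpow_le_rpow_add _ _ (hq.trans hqp.le)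
      _ = _ := by rw [NNReal.mul_rpow]
  rw [← ENNReal.rpow_le_rpow_iff hp0]
  calc _ ≤ _ := hfin
    _ = infEDist x F ^ p * ((C * K : ℝ≥0) : ℝ≥0∞) := by push_cast; ring
    _ ≤ infEDist x F ^ p * ((((C' + A / 2) * l) ^ p : ℝ≥0) : ℝ≥0∞) := by gcongr
    _ = _ := by
      rw [ENNReal.coe_rpow_of_nonneg _ hp0.le, ← ENNReal.mul_rpow_of_nonneg _ _ hp0.le]
      push_cast
      ring_nf

end Analysis

lemma exists_natCast_ne_zero_mul_rpow_le {p : ℝ} (hp : 1 < p) (a b : ℝ≥0) {ε : ℝ≥0} (hε : 0 < ε) :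
    ∃ N : ℕ, N ≠ 0 ∧ a * ((2 / N) ^ p * N * b) ≤ ε := by
  have h1 : Filter.Tendsto (fun N : ℕ => a * 2 ^ p * b * (N : ℝ≥0) ^ (-(p - 1)))
      Filter.atTop (nhds (a * 2 ^ p * b * 0)) := by
    refine Filter.Tendsto.const_mul _ ?_
    have h2 := (tendsto_rpow_neg_atTop (y := p - 1) (by linarith)).comp
      (tendsto_natCast_atTop_atTop (R := ℝ))
    rw [← NNReal.tendsto_coe]
    refine h2.congr fun N => ?_
    simp
  rw [mul_zero] at h1
  obtain ⟨N, hN0, hN⟩ := ((Filter.eventually_ne_atTop 0).and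
    (h1.eventually (gt_mem_nhds hε))).exists
  refine ⟨N, hN0, hN.le.trans' (le_of_eq ?_)⟩
  have hN1 : (N : ℝ≥0) ≠ 0 := by exact_mod_cast hN0
  rw [neg_sub, NNReal.rpow_sub hN1, NNReal.rpow_one, NNReal.div_rpow]
  ring

lemma exists_lt_lt_rpow_sub_le_two {p : ℝ} (hp : 1 < p) {M : ℝ≥0} (hM : M ≠ 0) :
    ∃ q, 1 < q ∧ q < p ∧ M ^ (p - q) ≤ 2 := by
  have h1 : Filter.Tendsto (fun q : ℝ => M ^ (p - q)) (nhdsWithin p (Set.Iio p)) (nhds 1) := by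
    have h2 : Filter.Tendsto (fun q : ℝ => (M : ℝ) ^ (p - q)) (nhds p) (nhds 1) := by
      have : Continuous fun q : ℝ => (M : ℝ) ^ (p - q) :=
        Continuous.rpow continuous_const (by fun_prop) fun q => Or.inl (by exact_mod_cast hM)
      simpa using this.tendsto p
    rw [← NNReal.tendsto_coe]
    simpa using h2.mono_left nhdsWithin_le_nhds
  obtain ⟨q, ⟨hq1, hq2⟩, hq⟩ := ((Filter.eventually_mem_set.2 (Ioo_mem_nhdsLT hp)).and
    (h1.eventually (gt_mem_nhds one_lt_two))).exists
  exact ⟨q, hq1, hq2, hq.le⟩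

section Analysis

variable {E : Type*} [NormedAddCommGroup E] [NormedSpace ℝ E] [FiniteDimensional ℝ E]
  [MeasurableSpace E] [BorelSpace E] (μ : Measure E) [μ.IsAddHaarMeasure]

variable {μ}

omit [NormedSpace ℝ E] [FiniteDimensional ℝ E] [BorelSpace E] [μ.IsAddHaarMeasure] in
lemma HardyBound.mono {q : ℝ} {F : Set E} {u : E → ℝ} {g : E → ℝ≥0∞} {A A' : ℝ≥0}
    (h : HardyBound μ q F u g A) (hA : A ≤ A') : HardyBound μ q F u g A' := fun x l hl hx =>
  (h x l hl hx).trans (by gcongr)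

omit [BorelSpace E] in
lemma hardyBound_of_le {q : ℝ} (hq : 0 < q) {F : Set E} {u : E → ℝ} {g : E → ℝ≥0∞} {L κ : ℝ≥0}
    (hu : LipschitzWith L u) (hF : ∀ y ∈ F, u y = 0) (hκ : 0 < κ) (hg : ∀ y, κ ≤ g y) :
    HardyBound μ q F u g ((L + 1) / κ) := by
  intro x l hl hx
  have h1 : ‖u x‖ₑ ≤ (L + 1 : ℝ≥0) * infEDist x F := by
    rw [mul_comm, ← ENNReal.div_le_iff (by simp) (by simp)]
    refine le_infEDist.2 fun y hy => ?_
    rw [ENNReal.div_le_iff (by simp) (by simp)]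
    have h2 := hu x y
    rw [hF y hy, edist_zero_right] at h2
    refine h2.trans ?_
    rw [mul_comm]
    gcongr
    exact le_add_of_nonneg_right zero_le_one
  have h3 : κ ≤ l := by
    have h4 : (κ : ℝ≥0∞) ^ q * μ (closedBall x 1) ≤ (l : ℝ≥0∞) ^ q * μ (closedBall x 1) := by
      refine (hx 1 one_pos).trans' ?_
      rw [← setLIntegral_const]
      exact lintegral_mono fun y => ENNReal.rpow_le_rpow (hg y) hq.le
    rw [ENNReal.mul_le_mul_iff_left (measure_closedBall_pos μ x one_pos).ne'
      measure_closedBall_lt_top.ne, ENNReal.rpow_le_rpow_iff hq] at h4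
    exact_mod_cast h4
  calc _ ≤ _ := h1
    _ = ((L + 1) / κ : ℝ≥0) * infEDist x F * κ := by
      rw [mul_right_comm, ← ENNReal.coe_mul, div_mul_cancel₀ _ hκ.ne']
    _ ≤ _ := by gcongr

variable (E) in
/-- Self-improvement of the pointwise Hardy inequality, for functions with a lower bound on
the gradient majorant. -/
theorem exists_hardyBound {p : ℝ} (hp : 1 < p) (C : ℝ≥0) :
    ∃ (q : ℝ) (A : ℝ≥0), 1 < q ∧ q < p ∧ 0 < A ∧ ∀ (F : Set E) (u : E → ℝ) (g : E → ℝ≥0∞)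
      (L κ : ℝ≥0), PointwiseHardy μ p C F → LipschitzWith L u → (∀ y ∈ F, u y = 0) →
      (∀ᵐ y ∂μ, ‖fderiv ℝ u y‖ₑ ≤ g y) → 0 < κ → (∀ y, κ ≤ g y) → HardyBound μ q F u g A := by
  set d := Module.finrank ℝ E with hd
  obtain ⟨N, hN0, hN⟩ := exists_natCast_ne_zero_mul_rpow_le hp (C * 2 ^ (p + 1)) (10 ^ d)
    (ε := (1 / 2) ^ p) (NNReal.rpow_pos (by norm_num))
  obtain ⟨q, hq1, hqp, hq⟩ := exists_lt_lt_rpow_sub_le_two hp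
    (M := 2 ^ (d + 1) * 2 ^ (d + N)) (by positivity)
  set C' : ℝ≥0 := max (2 ^ (d + 1)) ((C * 2 ^ (p + 1)) ^ p⁻¹) with hC'
  have hC'1 : 2 ^ (d + 1) ≤ C' := le_max_left _ _
  have hC'2 : C * 2 ^ (p + 1) ≤ C' ^ p :=
    (NNReal.rpow_inv_le_iff (by linarith)).1 (le_max_right _ _)
  have hC'0 : 0 < C' := lt_of_lt_of_le (by positivity) hC'1
  refine ⟨q, 2 * C', hq1, hqp, by positivity, fun F u g L κ hH hu hF hg hκ hgκ => ?_⟩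
  set A₀ := (L + 1) / κ with hA₀
  have hk : ∀ k : ℕ, HardyBound μ q F u g (2 * C' + A₀ / 2 ^ k) := by
    intro k
    induction k with
    | zero => exact (hardyBound_of_le (by linarith) hu hF hκ hgκ).mono (by simp [hA₀])
    | succ k ih =>
      refine (ih.contract hq1.le hqp hN0 hH ?_ hu hF hg hq hC'2 hN).mono (le_of_eq ?_)
      · calc (2 : ℝ≥0) ^ (d + 1) ≤ 2 * C' := hC'1.trans (le_mul_of_one_le_left zero_le one_le_two)
          _ ≤ _ := le_add_of_nonneg_right zero_le
      · rw [pow_succ, add_div, mul_div_cancel_left₀ _ two_ne_zero, div_div, ← add_assoc, two_mul]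
  intro x l hl hx
  have hlim : Filter.Tendsto (fun k : ℕ => 2 * C' + A₀ / 2 ^ k) Filter.atTop
      (nhds (2 * C')) := by
    have h1 : Filter.Tendsto (fun k : ℕ => A₀ * (2⁻¹ : ℝ≥0) ^ k) Filter.atTop (nhds (A₀ * 0)) :=
      (NNReal.tendsto_pow_atTop_nhds_zero_of_lt_one (by
        rw [← NNReal.coe_lt_coe]; norm_num)).const_mul _
    rw [mul_zero] at h1
    simpa [div_eq_mul_inv] using h1.const_add (2 * C')
  refine ge_of_tendsto (ENNReal.Tendsto.mul_const (ENNReal.Tendsto.mul_const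
    (ENNReal.tendsto_coe.2 hlim) (Or.inl ?_)) (Or.inr (by simp)))
    (Filter.Eventually.of_forall fun k => hk k x l hl hx)
  exact_mod_cast (mul_pos two_pos hC'0).ne'

end Analysis

section Cutoff

variable {X : Type*} [PseudoMetricSpace X]

/-- A Lipschitz cutoff function, equal to `1` on `closedBall w d` and to `0` off
`ball w (3 / 2 * d)`. -/
noncomputable def ballCutoff (w : X) (d : ℝ) (y : X) : ℝ := max 0 (min 1 (3 - 2 / d * dist y w))

lemma ballCutoff_nonneg (w : X) (d : ℝ) (y : X) : 0 ≤ ballCutoff w d y := le_max_left _ _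

lemma ballCutoff_le_one (w : X) (d : ℝ) (y : X) : ballCutoff w d y ≤ 1 :=
  max_le zero_le_one (min_le_left _ _)

lemma ballCutoff_eq_one {w y : X} {d : ℝ} (hd : 0 < d) (hy : dist y w ≤ d) :
    ballCutoff w d y = 1 := by
  have : 2 / d * dist y w ≤ 2 := by
    rw [div_mul_eq_mul_div, div_le_iff₀ hd]
    linarith
  rw [ballCutoff, min_eq_left (by linarith), max_eq_right zero_le_one]

lemma ballCutoff_eq_zero {w y : X} {d : ℝ} (hd : 0 < d) (hy : 3 / 2 * d ≤ dist y w) :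
    ballCutoff w d y = 0 := by
  have : 3 ≤ 2 / d * dist y w := by
    rw [div_mul_eq_mul_div, le_div_iff₀ hd]
    linarith
  rw [ballCutoff, max_eq_left]
  exact (min_le_right _ _).trans (by linarith)

lemma abs_ballCutoff_sub_le (w : X) {d : ℝ} (hd : 0 < d) (a y : X) :
    |ballCutoff w d a - ballCutoff w d y| ≤ 2 / d * dist a y := by
  have h1 : |ballCutoff w d a - ballCutoff w d y| ≤
      |(3 - 2 / d * dist a w) - (3 - 2 / d * dist y w)| :=
    (abs_max_sub_max_le_max _ _ _ _).trans (by
      rw [sub_self, abs_zero]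
      refine max_le (abs_nonneg _) ((abs_min_sub_min_le_max _ _ _ _).trans ?_)
      rw [sub_self, abs_zero]
      exact max_le (abs_nonneg _) le_rfl)
  refine h1.trans ?_
  rw [show (3 - 2 / d * dist a w) - (3 - 2 / d * dist y w) = 2 / d * (dist y w - dist a w) by ring,
    abs_mul, abs_of_pos (by positivity)]
  gcongr
  rw [dist_comm a y]
  exact abs_dist_sub_le y a w

lemma lipschitzWith_ballCutoff (w : X) {d : ℝ} (hd : 0 < d) :
    LipschitzWith (2 / d).toNNReal (ballCutoff w d) := by
  refine LipschitzWith.of_dist_le_mul fun a y => ?_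
  rw [Real.dist_eq, Real.coe_toNNReal _ (by positivity)]
  exact abs_ballCutoff_sub_le w hd a y

lemma tsupport_subset_of_le_ballCutoff {w : X} {d : ℝ} (hd : 0 < d) {φ : X → ℝ}
    (hφ : ∀ y, |φ y| ≤ ballCutoff w d y) : tsupport φ ⊆ closedBall w (3 / 2 * d) := by
  refine closure_minimal (fun y hy => ?_) isClosed_closedBall
  by_contra h
  rw [mem_closedBall, not_le] at h
  refine hy (abs_nonpos_iff.1 ((hφ y).trans ?_))
  rw [ballCutoff_eq_zero hd h.le]

lemma tsupport_subset_ball_of_le_ballCutoff {w : X} {d : ℝ} (hd : 0 < d) {φ : X → ℝ}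
    (hφ : ∀ y, |φ y| ≤ ballCutoff w d y) : tsupport φ ⊆ ball w (2 * d) :=
  (tsupport_subset_of_le_ballCutoff hd hφ).trans (closedBall_subset_ball (by linarith))

lemma hasCompactSupport_of_le_ballCutoff [ProperSpace X] {w : X} {d : ℝ} (hd : 0 < d) {φ : X → ℝ}
    (hφ : ∀ y, |φ y| ≤ ballCutoff w d y) : HasCompactSupport φ :=
  (isCompact_closedBall w _).of_isClosed_subset (isClosed_tsupport φ)
    (tsupport_subset_of_le_ballCutoff hd hφ)

end Cutoff

section Analysis

variable {E : Type*} [NormedAddCommGroup E] [NormedSpace ℝ E] [FiniteDimensional ℝ E]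
  [MeasurableSpace E] [BorelSpace E] (μ : Measure E) [μ.IsAddHaarMeasure]

/-- A capacity lower bound for superlevel sets, in terms of measure. -/
theorem measure_le_lintegral_fderiv_of_half_le [Nontrivial E] {φ : E → ℝ} {L : ℝ≥0}
    (hφ : LipschitzWith L φ) {z : E} {r : ℝ} (hr : 0 < r) (h0 : ∀ y ∉ ball z (2 * r), φ y = 0)
    {S : Set E} (hS : S ⊆ closedBall z r) (hS1 : ∀ y ∈ S, 1 / 2 ≤ φ y) {s : ℝ} (hs : 1 ≤ s) :
    μ S ≤ 2 * 25 ^ Module.finrank ℝ E * 10 ^ s *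
      (ENNReal.ofReal r ^ s * ∫⁻ y, ‖fderiv ℝ φ y‖ₑ ^ s ∂μ) := by
  set d := Module.finrank ℝ E with hd
  have hs0 : 0 < s := by linarith
  set M : ℝ≥0∞ := ENNReal.ofReal (10 * r) ^ s * (2 * 5 ^ d) with hM
  have hr0 : ENNReal.ofReal (10 * r) ^ s ≠ 0 := by
    simp [ENNReal.rpow_eq_zero_iff, hs0, hr, not_lt.2 hs0.le]
  have hrt : ENNReal.ofReal (10 * r) ^ s ≠ ⊤ :=
    ENNReal.rpow_ne_top_of_nonneg hs0.le ENNReal.ofReal_ne_top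
  have hM0 : M ≠ 0 := mul_ne_zero hr0 (by simp)
  have hMt : M ≠ ⊤ := ENNReal.mul_ne_top hrt (ENNReal.mul_ne_top (by simp) (by simp))
  obtain ⟨e, he⟩ := exists_norm_eq E (c := 3 * r) (by positivity)
  have hdist : dist (z + e) z = 3 * r := by simp [dist_eq_norm, he]
  have key := mul_measure_le_of_forall_closedBall μ (μ.withDensity fun y => ‖fderiv ℝ φ y‖ₑ ^ s)
    (R := 5 * r) (U := Set.univ) (c := M⁻¹) (S := S) ?_
  · rw [withDensity_apply _ MeasurableSet.univ, setLIntegral_univ, mul_comm,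
      ← div_eq_mul_inv, ENNReal.div_le_iff hM0 hMt] at key
    refine key.trans (le_of_eq ?_)
    rw [hM, ENNReal.ofReal_mul (by norm_num), ENNReal.mul_rpow_of_nonneg _ _ hs0.le,
      show (25 : ℝ≥0∞) = 5 * 5 by norm_num, mul_pow]
    norm_num
    ring
  · intro y hy
    by_contra! hcon
    have hK : ∀ t, 0 < t → t ≤ 5 * r →
        ∫⁻ a in closedBall y t, ‖fderiv ℝ φ a‖ₑ ^ s ∂μ ≤ M⁻¹ * μ (closedBall y t) := by
      intro t ht htr
      have := (hcon t ht htr (Set.subset_univ _)).le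
      rwa [withDensity_apply _ measurableSet_closedBall] at this
    have h1 := lintegral_enorm_sub_rpow_le μ hφ hs (by positivity : 0 < 5 * r) hK
    have hyz : dist y z ≤ r := hS hy
    have hsub : closedBall (z + e) r ⊆ closedBall y (5 * r) :=
      closedBall_subset_closedBall' (by
        have := dist_triangle (z + e) z y
        rw [dist_comm z y] at this
        linarith)
    have h2 : (2⁻¹ : ℝ≥0∞) ^ s * μ (closedBall (z + e) r) ≤
        ∫⁻ a in closedBall y (5 * r), ‖φ a - φ y‖ₑ ^ s ∂μ := by
      refine le_trans ?_ (lintegral_mono_set hsub)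
      rw [← setLIntegral_const]
      refine setLIntegral_mono' measurableSet_closedBall fun a ha => ?_
      refine ENNReal.rpow_le_rpow ?_ hs0.le
      have ha' : dist a (z + e) ≤ r := ha
      have : φ a = 0 := h0 a (by
        rw [mem_ball, not_lt]
        have := dist_triangle (z + e) a z
        rw [dist_comm (z + e) a] at this
        linarith)
      rw [this, zero_sub, enorm_neg, Real.enorm_eq_ofReal_abs]
      rw [show (2⁻¹ : ℝ≥0∞) = ENNReal.ofReal 2⁻¹ by
        rw [ENNReal.ofReal_inv_of_pos two_pos]; simp]
      refine ENNReal.ofReal_le_ofReal (le_trans ?_ (le_abs_self _))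
      linarith [hS1 y hy]
    have h3 := h2.trans h1
    rw [measure_closedBall_mul_radius μ y (by norm_num), Measure.addHaar_closedBall_center μ y,
      Measure.addHaar_closedBall_center μ (z + e), ← mul_assoc, ← mul_assoc] at h3
    have hb0 : μ (closedBall (0 : E) r) ≠ 0 := (measure_closedBall_pos μ 0 hr).ne'
    have hbt : μ (closedBall (0 : E) r) ≠ ⊤ := measure_closedBall_lt_top.ne
    rw [ENNReal.mul_le_mul_iff_left hb0 hbt] at h3
    have h4 : ENNReal.ofReal (5 * r) ^ s = 2⁻¹ ^ s * ENNReal.ofReal (10 * r) ^ s := by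
      rw [← ENNReal.mul_rpow_of_nonneg _ _ hs0.le, show 5 * r = 2⁻¹ * (10 * r) by ring,
        ENNReal.ofReal_mul (by norm_num), ENNReal.ofReal_inv_of_pos two_pos]
      simp
    have h5 : ENNReal.ofReal (5 * r) ^ s * M⁻¹ * ENNReal.ofReal (5 ^ d) = 2⁻¹ ^ s * 2⁻¹ := by
      rw [hM, ENNReal.mul_inv (Or.inl hr0) (Or.inl hrt),
        ENNReal.mul_inv (Or.inl (by simp)) (Or.inl (by simp)), h4,
        ENNReal.ofReal_pow (by norm_num)]
      have h55 : ((5 : ℝ≥0∞) ^ d)⁻¹ * 5 ^ d = 1 := ENNReal.inv_mul_cancel (by simp) (by simp)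
      have hrr := ENNReal.mul_inv_cancel hr0 hrt
      rw [ENNReal.ofReal_ofNat]
      calc _ = 2⁻¹ ^ s * (ENNReal.ofReal (10 * r) ^ s * (ENNReal.ofReal (10 * r) ^ s)⁻¹) *
            (2⁻¹ * (((5 : ℝ≥0∞) ^ d)⁻¹ * 5 ^ d)) := by ring
        _ = _ := by rw [h55, hrr, mul_one, mul_one]
    rw [h5] at h3
    have h6 : (2⁻¹ : ℝ≥0∞) ^ s ≠ 0 := by simp [ENNReal.rpow_eq_zero_iff, not_lt.2 hs0.le]
    have h7 : (2⁻¹ : ℝ≥0∞) ^ s ≠ ⊤ := ENNReal.rpow_ne_top_of_nonneg hs0.le (by simp)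
    have h8 : (2⁻¹ : ℝ≥0∞) ^ s * 1 ≤ 2⁻¹ ^ s * 2⁻¹ := by rwa [mul_one]
    rw [ENNReal.mul_le_mul_iff_right h6 h7] at h8
    exact absurd h8 (by norm_num)

/-- Scale-invariant lower bound for the energy of admissible functions of the condenser
`(K ∩ closedBall z r, ball z (2 * r))`. -/
def FatAt (p : ℝ) (c : ℝ≥0) (K : Set E) (z : E) (r : ℝ) : Prop :=
  ∀ (φ : E → ℝ) (L : ℝ≥0), LipschitzWith L φ → HasCompactSupport φ → tsupport φ ⊆ ball z (2 * r) →
    (∀ x ∈ K ∩ closedBall z r, 1 ≤ φ x) →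
    c * μ (closedBall z r) ≤ ENNReal.ofReal r ^ p * ∫⁻ y, ‖fderiv ℝ φ y‖ₑ ^ p ∂μ

end Analysis

section Analysis

variable {E : Type*} [NormedAddCommGroup E] [NormedSpace ℝ E] [FiniteDimensional ℝ E]
  [MeasurableSpace E] [BorelSpace E] (μ : Measure E) [μ.IsAddHaarMeasure]

lemma enorm_rpow_le_of_closedBall_subset_zero {v : E → ℝ} {L : ℝ≥0} (hv : LipschitzWith L v)
    {p : ℝ} (hp : 1 ≤ p) {x w : E} {d : ℝ} (hd : 0 < d) (hw : dist w x ≤ 2 * d)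
    (h0 : ∀ y ∈ closedBall w d, v y = 0) {K : ℝ≥0∞}
    (hK : MaximalLE μ (fun y => ‖fderiv ℝ v y‖ₑ ^ p) x K) :
    ‖v x‖ₑ ^ p ≤ 3 ^ p * 3 ^ Module.finrank ℝ E * ENNReal.ofReal d ^ p * K := by
  have hp0 : 0 < p := by linarith
  have h1 := lintegral_enorm_sub_rpow_le μ hv hp (by positivity : 0 < 3 * d) fun t ht _ => hK t ht
  have h2 : ‖v x‖ₑ ^ p * μ (closedBall w d) ≤
      ∫⁻ y in closedBall x (3 * d), ‖v y - v x‖ₑ ^ p ∂μ := by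
    refine le_trans ?_ (lintegral_mono_set (closedBall_subset_closedBall'
      (by linarith : d + dist w x ≤ 3 * d)))
    rw [← setLIntegral_const]
    refine setLIntegral_mono' measurableSet_closedBall fun y hy => ?_
    rw [h0 y hy, zero_sub, enorm_neg]
  have h3 := h2.trans h1
  rw [measure_closedBall_mul_radius μ x (by norm_num), Measure.addHaar_closedBall_center μ x,
    Measure.addHaar_closedBall_center μ w, ← mul_assoc, ← mul_assoc,
    ENNReal.mul_le_mul_iff_left (measure_closedBall_pos μ 0 hd).ne' measure_closedBall_lt_top.ne]
    at h3
  refine h3.trans (le_of_eq ?_)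
  rw [ENNReal.ofReal_mul (by norm_num), ENNReal.mul_rpow_of_nonneg _ _ hp0.le,
    ENNReal.ofReal_pow (by norm_num)]
  norm_num
  ring

omit [FiniteDimensional ℝ E] [MeasurableSpace E] [BorelSpace E] in
lemma norm_fderiv_ballCutoff_mul_min_le {v : E → ℝ} {x w y : E} {d : ℝ} (hd : 0 < d)
    (hy : DifferentiableAt ℝ v y) :
    ‖fderiv ℝ (fun y => ballCutoff w d y * min 1 |1 - v y / v x|) y‖ ≤
      ‖fderiv ℝ v y‖ / |v x| + 2 / d * |1 - v y / v x| := by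
  have h1 : ‖fderiv ℝ (fun y => ballCutoff w d y * min 1 |1 - v y / v x|) y‖ ≤
      ‖fderiv ℝ (fun y => v y / v x) y‖ + 2 / d * |1 - v y / v x| := by
    refine norm_fderiv_le_add_of_forall_abs_sub_le (by positivity)
      (by simp only [div_eq_mul_inv]; exact hy.mul_const _) fun a => ?_
    have h2 : |min 1 |1 - v a / v x| - min 1 (|1 - v y / v x|)| ≤ |v a / v x - v y / v x| := by
      refine (abs_min_sub_min_le_max _ _ _ _).trans ?_
      rw [sub_self, abs_zero]
      refine max_le (abs_nonneg _) ((abs_abs_sub_abs_le _ _).trans (le_of_eq ?_))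
      rw [← abs_neg]
      congr 1
      ring
    have h3 := abs_ballCutoff_sub_le w hd a y
    rw [dist_eq_norm] at h3
    calc _ = |ballCutoff w d a * (min 1 |1 - v a / v x| - min 1 (|1 - v y / v x|)) +
          min 1 (|1 - v y / v x|) * (ballCutoff w d a - ballCutoff w d y)| := by congr 1; ring
      _ ≤ |ballCutoff w d a| * |min 1 |1 - v a / v x| - min 1 (|1 - v y / v x|)| +
          |min 1 (|1 - v y / v x|)| * |ballCutoff w d a - ballCutoff w d y| := by
        rw [← abs_mul, ← abs_mul]
        exact abs_add_le _ _
      _ ≤ 1 * |v a / v x - v y / v x| + |1 - v y / v x| * (2 / d * ‖a - y‖) := by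
        rw [abs_of_nonneg (ballCutoff_nonneg _ _ _),
          abs_of_nonneg (le_min zero_le_one (abs_nonneg (1 - v y / v x)))]
        gcongr
        · exact ballCutoff_le_one _ _ _
        · exact min_le_right _ _
      _ = _ := by ring
  refine h1.trans (le_of_eq ?_)
  simp_rw [div_eq_mul_inv (v _)]
  rw [fderiv_mul_const hy, norm_smul, norm_inv, Real.norm_eq_abs]
  ring

omit [NormedSpace ℝ E] [FiniteDimensional ℝ E] [MeasurableSpace E] [BorelSpace E] in
lemma exists_lipschitzWith_ballCutoff_mul_min {v : E → ℝ} {L : ℝ≥0} (hv : LipschitzWith L v)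
    (x w : E) {d : ℝ} (hd : 0 < d) :
    ∃ M, LipschitzWith M fun y => ballCutoff w d y * min 1 |1 - v y / v x| := by
  refine ⟨(2 / d + L / |v x|).toNNReal, LipschitzWith.of_dist_le_mul fun a y => ?_⟩
  rw [Real.dist_eq, Real.coe_toNNReal _ (by positivity)]
  have h2 : |min 1 |1 - v a / v x| - min 1 (|1 - v y / v x|)| ≤ L / |v x| * dist a y := by
    refine (abs_min_sub_min_le_max _ _ _ _).trans ?_
    rw [sub_self, abs_zero]
    refine max_le (by positivity) ((abs_abs_sub_abs_le _ _).trans ?_)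
    have h4 := hv.dist_le_mul a y
    rw [Real.dist_eq, abs_sub_comm] at h4
    rw [show 1 - v a / v x - (1 - v y / v x) = (v y - v a) / v x by ring, abs_div,
      div_mul_eq_mul_div]
    gcongr
  have h3 := abs_ballCutoff_sub_le w hd a y
  calc _ = |ballCutoff w d a * (min 1 |1 - v a / v x| - min 1 (|1 - v y / v x|)) +
        min 1 (|1 - v y / v x|) * (ballCutoff w d a - ballCutoff w d y)| := by congr 1; ring
    _ ≤ |ballCutoff w d a| * |min 1 |1 - v a / v x| - min 1 (|1 - v y / v x|)| +
        |min 1 (|1 - v y / v x|)| * |ballCutoff w d a - ballCutoff w d y| := by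
      rw [← abs_mul, ← abs_mul]
      exact abs_add_le _ _
    _ ≤ 1 * (L / |v x| * dist a y) + 1 * (2 / d * dist a y) := by
      rw [abs_of_nonneg (ballCutoff_nonneg _ _ _),
        abs_of_nonneg (le_min zero_le_one (abs_nonneg (1 - v y / v x)))]
      gcongr
      · exact ballCutoff_le_one _ _ _
      · exact min_le_left _ _
    _ = _ := by ring

lemma mul_enorm_rpow_le_of_fatAt {v : E → ℝ} {L : ℝ≥0} (hv : LipschitzWith L v)
    {p : ℝ} (hp : 1 ≤ p) {x w : E} {d : ℝ} (hd : 0 < d) (hw : dist w x ≤ d) {c : ℝ≥0} {A : Set E}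
    (hA : FatAt μ p c A w d) (h0 : ∀ y ∈ A, v y = 0) {K : ℝ≥0∞}
    (hK : MaximalLE μ (fun y => ‖fderiv ℝ v y‖ₑ ^ p) x K) :
    c * ‖v x‖ₑ ^ p ≤
      2 ^ (p - 1) * (1 + 6 ^ p) * 3 ^ Module.finrank ℝ E * ENNReal.ofReal d ^ p * K := by
  have hp0 : 0 < p := by linarith
  rcases eq_or_ne (v x) 0 with hx | hx
  · simp [hx, hp0]
  set φ : E → ℝ := fun y => ballCutoff w d y * min 1 |1 - v y / v x| with hφ
  obtain ⟨M, hM⟩ := exists_lipschitzWith_ballCutoff_mul_min hv x w hd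
  have hφle : ∀ y, |φ y| ≤ ballCutoff w d y := by
    intro y
    have h2 := le_min zero_le_one (abs_nonneg (1 - v y / v x))
    rw [hφ, abs_of_nonneg (mul_nonneg (ballCutoff_nonneg _ _ _) h2)]
    exact mul_le_of_le_one_right (ballCutoff_nonneg _ _ _) (min_le_left _ _)
  have hts := tsupport_subset_ball_of_le_ballCutoff hd hφle
  have h1 := hA φ M hM (hasCompactSupport_of_le_ballCutoff hd hφle) hts (by
    rintro y ⟨hyA, hyw⟩
    simp [hφ, h0 y hyA, ballCutoff_eq_one hd hyw])
  have hvx0 : ‖v x‖ₑ ^ p ≠ 0 := by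
    simp [ENNReal.rpow_eq_zero_iff, hx, not_lt.2 hp0.le]
  have hvxt : ‖v x‖ₑ ^ p ≠ ⊤ := ENNReal.rpow_ne_top_of_nonneg hp0.le enorm_ne_top
  have hd0 : ENNReal.ofReal d ≠ 0 := by simpa using hd
  have hgrad : ∀ᵐ y ∂μ, ‖fderiv ℝ φ y‖ₑ ^ p ≤ (‖v x‖ₑ ^ p)⁻¹ * (2 ^ (p - 1) *
      (‖fderiv ℝ v y‖ₑ ^ p + (2 * (ENNReal.ofReal d)⁻¹) ^ p * ‖v y - v x‖ₑ ^ p)) := by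
    filter_upwards [hv.ae_differentiableAt (μ := μ)] with y hy
    have h3 := norm_fderiv_ballCutoff_mul_min_le (x := x) (w := w) hd hy
    have h4 : ‖fderiv ℝ φ y‖ₑ ≤
        ‖v x‖ₑ⁻¹ * (‖fderiv ℝ v y‖ₑ + 2 * (ENNReal.ofReal d)⁻¹ * ‖v y - v x‖ₑ) := by
      have h5 : ‖fderiv ℝ v y‖ / |v x| + 2 / d * |1 - v y / v x| =
          |v x|⁻¹ * (‖fderiv ℝ v y‖ + 2 * d⁻¹ * |v y - v x|) := by
        have : 1 - v y / v x = -((v y - v x) / v x) := by field_simp; ring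
        rw [this, abs_neg, abs_div]
        field_simp
      rw [h5] at h3
      have h6 := ENNReal.ofReal_le_ofReal h3
      rw [ENNReal.ofReal_mul (by positivity), ENNReal.ofReal_add (by positivity) (by positivity),
        ENNReal.ofReal_mul (by positivity), ENNReal.ofReal_mul (by positivity),
        ENNReal.ofReal_inv_of_pos hd, ENNReal.ofReal_inv_of_pos (by positivity),
        ← Real.enorm_eq_ofReal_abs, ← Real.enorm_eq_ofReal_abs, ofReal_norm,
        ofReal_norm] at h6
      simpa using h6
    calc _ ≤ _ := ENNReal.rpow_le_rpow h4 hp0.le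
      _ ≤ _ := by
        rw [ENNReal.mul_rpow_of_nonneg _ _ hp0.le, ENNReal.inv_rpow,
          ← ENNReal.mul_rpow_of_nonneg _ _ hp0.le]
        gcongr
        exact ENNReal.rpow_add_le_mul_rpow_add_rpow _ _ hp
  have hint : ∫⁻ y, ‖fderiv ℝ φ y‖ₑ ^ p ∂μ =
      ∫⁻ y in closedBall x (3 * d), ‖fderiv ℝ φ y‖ₑ ^ p ∂μ := by
    rw [setLIntegral_eq_of_support_subset]
    intro y hy
    by_contra hyx
    refine hy ?_
    have : y ∉ tsupport φ := fun hyt => hyx (by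
      have h7 : dist y w < 2 * d := hts hyt
      have h8 := dist_triangle y w x
      rw [mem_closedBall]
      linarith)
    simp only [fderiv_of_notMem_tsupport ℝ this, enorm_eq_nnnorm, nnnorm_zero, ENNReal.coe_zero,
      ENNReal.zero_rpow_of_pos hp0]
  have hP := lintegral_enorm_sub_rpow_le μ hv hp (by positivity : 0 < 3 * d) fun t ht _ => hK t ht
  have hmeas : Measurable fun y => ‖fderiv ℝ v y‖ₑ ^ p :=
    (measurable_fderiv ℝ v).enorm.pow_const _
  have hfin : ∫⁻ y, ‖fderiv ℝ φ y‖ₑ ^ p ∂μ ≤ (‖v x‖ₑ ^ p)⁻¹ * (2 ^ (p - 1) *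
      ((1 + 6 ^ p) * K * μ (closedBall x (3 * d)))) := by
    rw [hint]
    calc _ ≤ _ := lintegral_mono_ae (ae_restrict_of_ae hgrad)
      _ = (‖v x‖ₑ ^ p)⁻¹ * (2 ^ (p - 1) * (∫⁻ y in closedBall x (3 * d), ‖fderiv ℝ v y‖ₑ ^ p ∂μ +
          (2 * (ENNReal.ofReal d)⁻¹) ^ p *
            ∫⁻ y in closedBall x (3 * d), ‖v y - v x‖ₑ ^ p ∂μ)) := by
        rw [lintegral_const_mul' _ _ (ENNReal.inv_ne_top.2 hvx0),
          lintegral_const_mul' _ _ (ENNReal.rpow_ne_top_of_nonneg (by linarith) (by simp)),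
          lintegral_add_left hmeas, lintegral_const_mul']
        exact ENNReal.rpow_ne_top_of_nonneg hp0.le
          (ENNReal.mul_ne_top (by simp) (ENNReal.inv_ne_top.2 hd0))
      _ ≤ (‖v x‖ₑ ^ p)⁻¹ * (2 ^ (p - 1) * (K * μ (closedBall x (3 * d)) +
          (2 * (ENNReal.ofReal d)⁻¹) ^ p * (ENNReal.ofReal (3 * d) ^ p *
            (K * μ (closedBall x (3 * d)))))) := by
        gcongr
        exact hK _ (by positivity)
      _ = _ := by
        rw [← mul_assoc (_ ^ p) (_ ^ p), ← ENNReal.mul_rpow_of_nonneg _ _ hp0.le,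
          ENNReal.ofReal_mul (by norm_num)]
        rw [show 2 * (ENNReal.ofReal d)⁻¹ * (ENNReal.ofReal 3 * ENNReal.ofReal d) =
          2 * ENNReal.ofReal 3 * ((ENNReal.ofReal d)⁻¹ * ENNReal.ofReal d) by ring,
          ENNReal.inv_mul_cancel hd0 ENNReal.ofReal_ne_top]
        norm_num
        ring
  have h9 := mul_le_mul' (h1.trans (mul_le_mul' le_rfl hfin)) (le_refl (‖v x‖ₑ ^ p))
  have hb0 : μ (closedBall (0 : E) d) ≠ 0 := (measure_closedBall_pos μ 0 hd).ne'
  rw [measure_closedBall_mul_radius μ x (by norm_num), Measure.addHaar_closedBall_center μ x,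
    Measure.addHaar_closedBall_center μ w] at h9
  rw [← ENNReal.mul_le_mul_iff_left hb0 measure_closedBall_lt_top.ne]
  calc _ = c * μ (closedBall 0 d) * ‖v x‖ₑ ^ p := by ring
    _ ≤ _ := h9
    _ = 2 ^ (p - 1) * (1 + 6 ^ p) * ENNReal.ofReal (3 ^ Module.finrank ℝ E) *
        ENNReal.ofReal d ^ p * K * μ (closedBall 0 d) * ((‖v x‖ₑ ^ p)⁻¹ * ‖v x‖ₑ ^ p) := by ring
    _ = _ := by
      rw [ENNReal.inv_mul_cancel hvx0 hvxt, mul_one, ENNReal.ofReal_pow (by norm_num),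
        ENNReal.ofReal_ofNat]

end Analysis

section Analysis

variable {E : Type*} [NormedAddCommGroup E] [NormedSpace ℝ E] [FiniteDimensional ℝ E]
  [MeasurableSpace E] [BorelSpace E] (μ : Measure E) [μ.IsAddHaarMeasure]

lemma FatAt.pointwiseHardy {p : ℝ} (hp : 1 ≤ p) {c : ℝ≥0} (hc : 0 < c) {S : Set E}
    (hS : IsClosed S) {z : E} (hz : z ∈ S) {r : ℝ}
    (h : ∀ w ∈ frontier S, ∀ d, 0 < d → d ≤ r → FatAt μ p c S w d) :
    PointwiseHardy μ p (3 ^ p * 3 ^ Module.finrank ℝ E +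
      2 ^ (p - 1) * (1 + 6 ^ p) * 3 ^ Module.finrank ℝ E / c) (S ∪ (ball z r)ᶜ) := by
  intro v L hv hvF x K hK
  have hp0 : 0 < p := by linarith
  set F := S ∪ (ball z r)ᶜ with hF
  have hFc : IsClosed F := hS.union isOpen_ball.isClosed_compl
  have hFn : F.Nonempty := ⟨z, Or.inl hz⟩
  by_cases hxF : x ∈ F
  · simp [hvF x hxF, hp0]
  set d := infDist x F with hd
  have hd0 : 0 < d := (hFc.notMem_iff_infDist_pos hFn).1 hxF
  have hinf : infEDist x F = ENNReal.ofReal d := by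
    rw [hd, infDist, ENNReal.ofReal_toReal (infEDist_ne_top hFn)]
  obtain ⟨w, hwF, hwd⟩ := hFc.exists_infDist_eq_dist hFn x
  have hxr : dist x z < r := by
    by_contra hcon
    exact hxF (Or.inr (by simpa using hcon))
  have hdr : d ≤ r := (infDist_le_dist_of_mem (show z ∈ F from Or.inl hz)).trans hxr.le
  rw [hinf]
  by_cases hwS : w ∈ S
  · have hball : ball x d ⊆ Sᶜ := fun y hy hyS =>
      absurd (infDist_le_dist_of_mem (x := x) (show y ∈ F from Or.inl hyS)) (not_le.2 (by
        rw [dist_comm]; exact hy))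
    have hwfr : w ∈ frontier S := by
      rw [frontier_eq_closure_inter_closure]
      refine ⟨subset_closure hwS, closure_mono hball ?_⟩
      rw [closure_ball x hd0.ne', mem_closedBall, dist_comm]
      exact hwd.ge
    have h1 := mul_enorm_rpow_le_of_fatAt μ hv hp hd0 (by rw [dist_comm]; exact hwd.ge)
      (h w hwfr d hd0 hdr) (fun y hy => hvF y (Or.inl hy)) hK
    have hc0 : (c : ℝ≥0∞) ≠ 0 := by exact_mod_cast hc.ne'
    have h2 : ‖v x‖ₑ ^ p ≤ (c : ℝ≥0∞)⁻¹ * (2 ^ (p - 1) * (1 + 6 ^ p) *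
        3 ^ Module.finrank ℝ E * ENNReal.ofReal d ^ p * K) := by
      rw [mul_comm, ← div_eq_mul_inv, ENNReal.le_div_iff_mul_le (Or.inl hc0) (Or.inl (by simp)),
        mul_comm]
      exact h1
    refine h2.trans ?_
    have h3 : (c : ℝ≥0∞)⁻¹ * (2 ^ (p - 1) * (1 + 6 ^ p) * 3 ^ Module.finrank ℝ E) ≤
        ((3 ^ p * 3 ^ Module.finrank ℝ E +
          2 ^ (p - 1) * (1 + 6 ^ p) * 3 ^ Module.finrank ℝ E / c : ℝ≥0) : ℝ≥0∞) := by
      rw [ENNReal.coe_add, ENNReal.coe_div hc.ne']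
      refine le_add_left (le_of_eq ?_)
      push_cast
      rw [ENNReal.coe_rpow_of_nonneg _ (by linarith), ENNReal.coe_rpow_of_nonneg _ hp0.le,
        div_eq_mul_inv, mul_comm]
      push_cast
      rfl
    calc _ = (c : ℝ≥0∞)⁻¹ * (2 ^ (p - 1) * (1 + 6 ^ p) * 3 ^ Module.finrank ℝ E) *
          ENNReal.ofReal d ^ p * K := by ring
      _ ≤ _ := by gcongr
  · have hwz : r ≤ dist w z := by
      rcases hwF with h4 | h4
      · exact absurd h4 hwS
      · simpa using h4
    have hwz0 : 0 < dist w z := dist_nonneg.trans_lt hxr |>.trans_le hwz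
    set e := (d / dist w z) • (w - z) with he
    have hen : ‖e‖ = d := by
      rw [he, norm_smul, Real.norm_of_nonneg (by positivity), ← dist_eq_norm,
        div_mul_cancel₀ _ hwz0.ne']
    have hez : dist (w + e) z = dist w z + d := by
      rw [dist_eq_norm, show w + e - z = (1 + d / dist w z) • (w - z) by
        rw [he, add_smul, one_smul]; abel, norm_smul, Real.norm_of_nonneg (by positivity),
        ← dist_eq_norm]
      field_simp
    have h1 := enorm_rpow_le_of_closedBall_subset_zero μ hv hp (x := x) (w := w + e) hd0 (by
      have h5 : dist (w + e) w = d := by rw [dist_eq_norm, add_sub_cancel_left, hen]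
      have h6 := dist_triangle (w + e) w x
      rw [dist_comm w x] at h6
      linarith) (fun y hy => hvF y (Or.inr (by
        have h7 : dist y (w + e) ≤ d := hy
        have h8 := dist_triangle (w + e) y z
        rw [dist_comm (w + e) y] at h8
        rw [Set.mem_compl_iff, mem_ball, not_lt]
        linarith))) hK
    refine h1.trans ?_
    have h3 : (3 : ℝ≥0∞) ^ p * 3 ^ Module.finrank ℝ E ≤ ((3 ^ p * 3 ^ Module.finrank ℝ E +
          2 ^ (p - 1) * (1 + 6 ^ p) * 3 ^ Module.finrank ℝ E / c : ℝ≥0) : ℝ≥0∞) := by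
      rw [ENNReal.coe_add]
      refine le_add_right (le_of_eq ?_)
      push_cast
      rw [ENNReal.coe_rpow_of_nonneg _ hp0.le]
      rfl
    gcongr

lemma mul_measure_le_of_hardyBound {q : ℝ} (hq : 1 ≤ q) {A : ℝ≥0} (hA : 0 < A) {S : Set E}
    {z : E} (hz : z ∈ S) {r : ℝ} (hr : 0 < r) {φ : E → ℝ} {L : ℝ≥0}
    (hφL : LipschitzWith L φ) (hφ : ∀ x ∈ S ∩ closedBall z r, 1 ≤ φ x)
    (h : ∀ (u : E → ℝ) (g : E → ℝ≥0∞) (L κ : ℝ≥0), LipschitzWith L u →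
      (∀ y ∈ S ∪ (ball z r)ᶜ, u y = 0) → (∀ᵐ y ∂μ, ‖fderiv ℝ u y‖ₑ ≤ g y) → 0 < κ →
      (∀ y, κ ≤ g y) → HardyBound μ q (S ∪ (ball z r)ᶜ) u g A) {ε : ℝ} (hε : ε ≤ 1 / 2)
    (hεA : ε * (20 * A) ≤ 1) {T : Set E} (hT : T ⊆ closedBall z (ε * r))
    (hφT : ∀ y ∈ T, φ y < 1 / 2) :
    μ T ≤ 5 ^ Module.finrank ℝ E * (ENNReal.ofReal r ^ q * ∫⁻ y, ‖fderiv ℝ φ y‖ₑ ^ q ∂μ) := by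
  have hq0 : 0 < q := by linarith
  set κ : ℝ≥0 := (4 / r).toNNReal with hκ
  have hκr : (κ : ℝ) = 4 / r := Real.coe_toNNReal _ (by positivity)
  set v : E → ℝ := fun y => min (ballCutoff z (r / 2) y) (max 0 (1 - φ y)) with hv
  set g : E → ℝ≥0∞ := fun y => ‖fderiv ℝ φ y‖ₑ + κ with hg
  have hηL := lipschitzWith_ballCutoff z (half_pos hr)
  have hvL : ∃ M, LipschitzWith M v :=
    ⟨_, hηL.min (((LipschitzWith.const (1 : ℝ)).sub hφL).const_max 0)⟩
  obtain ⟨M, hvM⟩ := hvL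
  have hvF : ∀ y ∈ S ∪ (ball z r)ᶜ, v y = 0 := by
    intro y hy
    have hη0 := ballCutoff_nonneg z (r / 2) y
    by_cases hyr : y ∈ ball z r
    · have hyS : y ∈ S := hy.resolve_right (not_not.2 hyr)
      have := hφ y ⟨hyS, ball_subset_closedBall hyr⟩
      simp only [hv]
      rw [max_eq_left (by linarith), min_eq_right hη0]
    · rw [mem_ball, not_lt] at hyr
      simp only [hv]
      rw [ballCutoff_eq_zero (half_pos hr) (by linarith), min_eq_left (le_max_left _ _)]
  have hgrad : ∀ᵐ y ∂μ, ‖fderiv ℝ v y‖ₑ ≤ g y := by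
    filter_upwards [hφL.ae_differentiableAt (μ := μ)] with y hy
    have h1 : ‖fderiv ℝ v y‖ ≤ ‖fderiv ℝ φ y‖ + 4 / r := by
      refine norm_fderiv_le_add_of_forall_abs_sub_le (by positivity) hy fun a => ?_
      refine (abs_min_sub_min_le_max _ _ _ _).trans (max_le ?_ ?_)
      · have h2 := abs_ballCutoff_sub_le z (half_pos hr) a y
        rw [dist_eq_norm, show 2 / (r / 2) = 4 / r by field_simp; norm_num] at h2
        exact h2.trans (le_add_of_nonneg_left (abs_nonneg _))
      · refine (abs_max_sub_max_le_max _ _ _ _).trans ?_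
        rw [sub_self, abs_zero, show 1 - φ a - (1 - φ y) = -(φ a - φ y) by ring, abs_neg]
        exact max_le (by positivity) (le_add_of_nonneg_right (by positivity))
    have h3 := ENNReal.ofReal_le_ofReal h1
    rwa [ENNReal.ofReal_add (by positivity) (by positivity), ofReal_norm, ofReal_norm] at h3
  have hH := h v g M κ hvM hvF hgrad (by rw [← NNReal.coe_pos, hκr]; positivity)
    fun y => le_add_self
  set l : ℝ≥0 := (10 / r).toNNReal with hl
  have hlr : (l : ℝ) = 10 / r := Real.coe_toNNReal _ (by positivity)
  have hl0 : 0 < l := by rw [← NNReal.coe_pos, hlr]; positivity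
  have hr0 : ENNReal.ofReal r ≠ 0 := by simpa using hr
  have hrq0 : ENNReal.ofReal r ^ q ≠ 0 := by
    simp [ENNReal.rpow_eq_zero_iff, hr, not_lt.2 hq0.le]
  have hrqt : ENNReal.ofReal r ^ q ≠ ⊤ := ENNReal.rpow_ne_top_of_nonneg hq0.le (by simp)
  set k : ℝ≥0∞ := (ENNReal.ofReal r ^ q)⁻¹ with hk
  have hκk : (κ : ℝ≥0∞) ^ q = 4 ^ q * k := by
    have : (κ : ℝ≥0∞) = 4 * (ENNReal.ofReal r)⁻¹ := by
      change ENNReal.ofReal (4 / r) = _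
      rw [ENNReal.ofReal_div_of_pos hr, div_eq_mul_inv, ENNReal.ofReal_ofNat]
    rw [this, ENNReal.mul_rpow_of_nonneg _ _ hq0.le, ENNReal.inv_rpow]
  have hlk : (l : ℝ≥0∞) ^ q = 10 ^ q * k := by
    have : (l : ℝ≥0∞) = 10 * (ENNReal.ofReal r)⁻¹ := by
      change ENNReal.ofReal (10 / r) = _
      rw [ENNReal.ofReal_div_of_pos hr, div_eq_mul_inv, ENNReal.ofReal_ofNat]
    rw [this, ENNReal.mul_rpow_of_nonneg _ _ hq0.le, ENNReal.inv_rpow]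
  have hkt : k ≠ ⊤ := ENNReal.inv_ne_top.2 hrq0
  have hlarge : ∀ y ∈ T, ∃ ρ, 0 < ρ ∧
      k * μ (closedBall y ρ) ≤ ∫⁻ a in closedBall y ρ, ‖fderiv ℝ φ a‖ₑ ^ q ∂μ := by
    intro y hy
    have hyz : dist y z ≤ ε * r := hT hy
    have hvy : 1 / 2 < v y := by
      simp only [hv]
      rw [ballCutoff_eq_one (half_pos hr) (by nlinarith)]
      refine lt_min (by norm_num) (lt_max_of_lt_right ?_)
      linarith [hφT y hy]
    have hnot : ¬ MaximalLE μ (fun y => g y ^ q) y ((l : ℝ≥0∞) ^ q) := by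
      intro hM
      have h1 := hH y l hl0 hM
      have h2 : infEDist y (S ∪ (ball z r)ᶜ) ≤ ENNReal.ofReal (ε * r) :=
        (infEDist_le_edist_of_mem
          (show z ∈ S ∪ (ball z r)ᶜ from Or.inl hz)).trans (by
          rw [edist_dist]; exact ENNReal.ofReal_le_ofReal hyz)
      have hAε : 0 ≤ (A : ℝ) * (ε * r) := mul_nonneg A.coe_nonneg (dist_nonneg.trans hyz)
      have h3 : ‖v y‖ₑ ≤ ENNReal.ofReal (A * (ε * r) * (10 / r)) := by
        refine h1.trans ?_
        rw [ENNReal.ofReal_mul hAε, ENNReal.ofReal_mul A.coe_nonneg,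
          ENNReal.ofReal_coe_nnreal]
        exact mul_le_mul' (mul_le_mul' le_rfl h2) le_rfl
      rw [Real.enorm_eq_ofReal_abs, ENNReal.ofReal_le_ofReal_iff
        (mul_nonneg hAε (by positivity))] at h3
      have h4 : A * (ε * r) * (10 / r) = ε * (20 * A) / 2 := by field_simp; ring
      rw [h4] at h3
      linarith [le_abs_self (v y)]
    simp only [MaximalLE, not_forall, not_le] at hnot
    obtain ⟨ρ, hρ, hlt⟩ := hnot
    refine ⟨ρ, hρ, ?_⟩
    have hb0 : μ (closedBall y ρ) ≠ ⊤ := measure_closedBall_lt_top.ne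
    have hle : ∫⁻ a in closedBall y ρ, g a ^ q ∂μ ≤
        2 ^ q * (∫⁻ a in closedBall y ρ, ‖fderiv ℝ φ a‖ₑ ^ q ∂μ +
          4 ^ q * k * μ (closedBall y ρ)) := by
      rw [← hκk, ← setLIntegral_const, ← lintegral_add_right _ measurable_const,
        ← lintegral_const_mul' _ _ (ENNReal.rpow_ne_top_of_nonneg hq0.le (by simp))]
      refine lintegral_mono fun a => ?_
      refine (ENNReal.rpow_add_le_mul_rpow_add_rpow _ _ hq).trans ?_
      gcongr
      · norm_num
      · linarith
    have h5 := hlt.le.trans hle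
    rw [hlk, show (10 : ℝ≥0∞) = 2 * 5 by norm_num, ENNReal.mul_rpow_of_nonneg _ _ hq0.le,
      mul_assoc, mul_assoc, ENNReal.mul_le_mul_iff_right (by
        simp [ENNReal.rpow_eq_zero_iff, not_lt.2 hq0.le])
        (ENNReal.rpow_ne_top_of_nonneg hq0.le (by simp))] at h5
    have h6 : (1 : ℝ≥0∞) + 4 ^ q ≤ 5 ^ q := by
      have := ENNReal.add_rpow_le_rpow_add 1 4 hq
      rw [ENNReal.one_rpow] at this
      refine this.trans (le_of_eq ?_)
      norm_num
    have h7 : k * μ (closedBall y ρ) + 4 ^ q * k * μ (closedBall y ρ) ≤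
        ∫⁻ a in closedBall y ρ, ‖fderiv ℝ φ a‖ₑ ^ q ∂μ + 4 ^ q * k * μ (closedBall y ρ) := by
      refine le_trans ?_ h5
      calc _ = (1 + 4 ^ q) * (k * μ (closedBall y ρ)) := by ring
        _ ≤ _ := by gcongr
    exact (ENNReal.add_le_add_iff_right (ENNReal.mul_ne_top (ENNReal.mul_ne_top
      (ENNReal.rpow_ne_top_of_nonneg hq0.le (by simp)) hkt) hb0)).1 h7
  have hfin : k * μ T ≤ 5 ^ Module.finrank ℝ E * ∫⁻ y, ‖fderiv ℝ φ y‖ₑ ^ q ∂μ := by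
    by_cases hbig : ∃ y ∈ T, ∃ ρ, r ≤ ρ ∧
        k * μ (closedBall y ρ) ≤ ∫⁻ a in closedBall y ρ, ‖fderiv ℝ φ a‖ₑ ^ q ∂μ
    · obtain ⟨y, hy, ρ, hρ, hle⟩ := hbig
      calc k * μ T ≤ k * μ (closedBall y ρ) := by
            rw [Measure.addHaar_closedBall_center μ y, ← Measure.addHaar_closedBall_center μ z]
            gcongr
            exact hT.trans (closedBall_subset_closedBall (by nlinarith))
        _ ≤ _ := hle
        _ ≤ ∫⁻ y, ‖fderiv ℝ φ y‖ₑ ^ q ∂μ := setLIntegral_le_lintegral _ _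
        _ ≤ _ := le_mul_of_one_le_left zero_le (one_le_pow₀ (by norm_num))
    · have key := mul_measure_le_of_forall_closedBall μ
        (μ.withDensity fun y => ‖fderiv ℝ φ y‖ₑ ^ q) (R := r) (U := Set.univ) (c := k) (S := T) ?_
      · rwa [withDensity_apply _ MeasurableSet.univ, setLIntegral_univ] at key
      · intro y hy
        obtain ⟨ρ, hρ, hle⟩ := hlarge y hy
        refine ⟨ρ, hρ, ?_, Set.subset_univ _, ?_⟩
        · by_contra! hcon
          exact hbig ⟨y, hy, ρ, hcon.le, hle⟩
        · rwa [withDensity_apply _ measurableSet_closedBall]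
  rw [hk, mul_comm, ← div_eq_mul_inv, ENNReal.div_le_iff hrq0 hrqt] at hfin
  refine hfin.trans (le_of_eq ?_)
  ring

variable (E) in
/-- Self-improvement of uniform fatness, in scale-invariant form. -/
theorem exists_fatAt_of_fatAt [Nontrivial E] {p : ℝ} (hp : 1 < p) {c : ℝ≥0} (hc : 0 < c) :
    ∃ (q : ℝ) (c' : ℝ≥0), 1 < q ∧ q < p ∧ 0 < c' ∧ ∀ (S : Set E) (r₀ : ℝ), IsClosed S →
      (∀ z ∈ frontier S, ∀ r, 0 < r → r ≤ r₀ → FatAt μ p c S z r) →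
      ∀ z ∈ frontier S, ∀ r, 0 < r → r ≤ r₀ → FatAt μ q c' S z r := by
  obtain ⟨q, A, hq1, hqp, hA, H⟩ := exists_hardyBound E (μ := μ) hp
    (3 ^ p * 3 ^ Module.finrank ℝ E + 2 ^ (p - 1) * (1 + 6 ^ p) * 3 ^ Module.finrank ℝ E / c)
  set d := Module.finrank ℝ E with hd
  have hq0 : 0 < q := by linarith
  set ε : ℝ≥0 := min (1 / 2) (1 / (20 * A)) with hε
  have hε0 : 0 < ε := lt_min (by norm_num) (by positivity)
  set M : ℝ≥0 := 2 * 25 ^ d * 10 ^ q + 5 ^ d with hM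
  have hM0 : 0 < M := by positivity
  refine ⟨q, ε ^ d / M, hq1, hqp, by positivity, fun S r₀ hS hfat z hz r hr hrr => ?_⟩
  intro φ L hφL _ hφs hφ
  have hzS : z ∈ S := hS.frontier_subset hz
  have hPH := FatAt.pointwiseHardy μ hp.le hc hS hzS (r := r) fun w hw δ hδ hδr =>
    hfat w hw δ hδ (hδr.trans hrr)
  set I := ENNReal.ofReal r ^ q * ∫⁻ y, ‖fderiv ℝ φ y‖ₑ ^ q ∂μ with hI
  have hε1 : (ε : ℝ) ≤ 1 / 2 := by
    have : ε ≤ 1 / 2 := min_le_left _ _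
    exact_mod_cast this
  have hε2 : (ε : ℝ) * (20 * A) ≤ 1 := by
    have : ε * (20 * A) ≤ 1 := by
      rw [← le_div_iff₀ (by positivity)]
      exact min_le_right _ _
    exact_mod_cast this
  have h1 : μ (closedBall z (ε * r) ∩ {y | 1 / 2 ≤ φ y}) ≤ 2 * 25 ^ d * 10 ^ q * I := by
    refine measure_le_lintegral_fderiv_of_half_le μ hφL hr (z := z) (fun y hy => ?_)
      (Set.inter_subset_left.trans (closedBall_subset_closedBall (by nlinarith)))
      (fun y hy => hy.2) hq1.le
    exact image_eq_zero_of_notMem_tsupport fun hyt => hy (hφs hyt)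
  have h2 : μ (closedBall z (ε * r) \ {y | 1 / 2 ≤ φ y}) ≤ 5 ^ d * I :=
    mul_measure_le_of_hardyBound μ hq1.le hA hzS hr hφL hφ
      (fun u g L κ hu hF hg hκ hκg => H _ u g L κ hPH hu hF hg hκ hκg) hε1 hε2
      Set.sdiff_subset fun y hy => not_le.1 hy.2
  have h3 : (ε : ℝ≥0∞) ^ d * μ (closedBall z r) ≤ M * I := by
    calc _ = μ (closedBall z (ε * r)) := by
          rw [measure_closedBall_mul_radius μ z (by exact_mod_cast hε0),
            ENNReal.ofReal_pow (by positivity), ENNReal.ofReal_coe_nnreal]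
      _ ≤ _ := measure_le_inter_add_sdiff μ _ {y | 1 / 2 ≤ φ y}
      _ ≤ 2 * 25 ^ d * 10 ^ q * I + 5 ^ d * I := add_le_add h1 h2
      _ = _ := by
          rw [hM, ← add_mul]
          push_cast
          rw [ENNReal.coe_rpow_of_nonneg _ hq0.le]
          rfl
  rw [ENNReal.coe_div hM0.ne', div_eq_mul_inv, mul_right_comm, ← div_eq_mul_inv]
  rw [ENNReal.div_le_iff (by exact_mod_cast hM0.ne') (by simp), mul_comm I]
  exact_mod_cast h3

end Analysis

section Capacity

variable {n : ℕ}

lemma lintegral_enorm_fderiv_rpow_eq {p : ℝ} (hp : 0 < p)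
    {φ : EuclideanSpace ℝ (Fin n) → ℝ} {L : ℝ≥0} (hφ : LipschitzWith L φ)
    (hc : HasCompactSupport φ) {U : Set (EuclideanSpace ℝ (Fin n))} (hU : tsupport φ ⊆ U) :
    ∫⁻ y, ‖fderiv ℝ φ y‖ₑ ^ p = ENNReal.ofReal (∫ y in U, ‖fderiv ℝ φ y‖ ^ p) := by
  have h0 : ∀ y ∉ tsupport φ, ‖fderiv ℝ φ y‖ ^ p = 0 := fun y hy => by
    rw [fderiv_of_notMem_tsupport ℝ hy, norm_zero, Real.zero_rpow hp.ne']
  have hmeas : Measurable fun y => ‖fderiv ℝ φ y‖ ^ p :=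
    (measurable_fderiv ℝ φ).norm.pow_const _
  have hint : Integrable fun y => ‖fderiv ℝ φ y‖ ^ p := by
    refine (integrableOn_iff_integrable_of_support_subset (s := tsupport φ) fun y hy => ?_).1 ?_
    · by_contra hy'
      exact hy (h0 y hy')
    · refine Measure.integrableOn_of_bounded (M := (L : ℝ) ^ p)
        (IsCompact.measure_lt_top hc).ne hmeas.aestronglyMeasurable (ae_of_all _ fun y => ?_)
      rw [Real.norm_of_nonneg (by positivity)]
      exact Real.rpow_le_rpow (norm_nonneg _) (norm_fderiv_le_of_lipschitz ℝ hφ) hp.le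
  rw [setIntegral_eq_integral_of_forall_compl_eq_zero fun y hy => h0 y fun hyt => hy (hU hyt),
    ofReal_integral_eq_lintegral_ofReal hint (ae_of_all _ fun y => by positivity)]
  refine lintegral_congr fun y => ?_
  rw [← ENNReal.ofReal_rpow_of_nonneg (norm_nonneg _) hp.le, ofReal_norm]

lemma bddBelow_pCap_set (p : ℝ) (K U : Set (EuclideanSpace ℝ (Fin n))) :
    BddBelow { c : ℝ | ∃ φ : EuclideanSpace ℝ (Fin n) → ℝ, (∃ L : ℝ≥0, LipschitzWith L φ) ∧
      HasCompactSupport φ ∧ tsupport φ ⊆ U ∧ (∀ x ∈ K, 1 ≤ φ x) ∧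
      c = ∫ x in U, ‖fderiv ℝ φ x‖ ^ p } := by
  refine ⟨0, ?_⟩
  rintro c ⟨φ, -, -, -, -, rfl⟩
  exact integral_nonneg fun y => by positivity

lemma ballCutoff_mem_pCap_set (p : ℝ) {z : EuclideanSpace ℝ (Fin n)} {r : ℝ} (hr : 0 < r)
    {K : Set (EuclideanSpace ℝ (Fin n))} (hK : K ⊆ closedBall z r) :
    (∫ x in ball z (2 * r), ‖fderiv ℝ (ballCutoff z r) x‖ ^ p) ∈
      { c : ℝ | ∃ φ : EuclideanSpace ℝ (Fin n) → ℝ, (∃ L : ℝ≥0, LipschitzWith L φ) ∧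
      HasCompactSupport φ ∧ tsupport φ ⊆ ball z (2 * r) ∧ (∀ x ∈ K, 1 ≤ φ x) ∧
      c = ∫ x in ball z (2 * r), ‖fderiv ℝ φ x‖ ^ p } := by
  have h : ∀ y, |ballCutoff z r y| ≤ ballCutoff z r y := fun y =>
    (abs_of_nonneg (ballCutoff_nonneg z r y)).le
  exact ⟨ballCutoff z r, ⟨_, lipschitzWith_ballCutoff z hr⟩,
    hasCompactSupport_of_le_ballCutoff hr h, tsupport_subset_ball_of_le_ballCutoff hr h,
    fun x hx => (ballCutoff_eq_one hr (hK hx)).ge, rfl⟩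

lemma pCap_ball_le [NeZero n] {p : ℝ} (hp : 0 < p) (z : EuclideanSpace ℝ (Fin n)) {r : ℝ}
    (hr : 0 < r) :
    pCap n p (closedBall z r) (ball z (2 * r)) ≤
      2 ^ p * 2 ^ n * (r ^ p)⁻¹ * (volume (closedBall z r)).toReal := by
  refine (csInf_le (bddBelow_pCap_set _ _ _) (ballCutoff_mem_pCap_set p hr subset_rfl)).trans ?_
  have hb : ∀ y ∈ ball z (2 * r), ‖‖fderiv ℝ (ballCutoff z r) y‖ ^ p‖ ≤ (2 / r) ^ p := by
    intro y _
    rw [Real.norm_of_nonneg (by positivity)]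
    refine Real.rpow_le_rpow (norm_nonneg _) ?_ hp.le
    refine (norm_fderiv_le_of_lipschitz ℝ (lipschitzWith_ballCutoff z hr)).trans (le_of_eq ?_)
    rw [Real.coe_toNNReal _ (by positivity)]
  refine (le_abs_self _).trans ((norm_setIntegral_le_of_norm_le_const measure_ball_lt_top hb).trans
    (le_of_eq ?_))
  rw [measureReal_def, Measure.addHaar_ball_mul_of_pos volume z two_pos,
    Measure.addHaar_closedBall volume z hr.le, ENNReal.toReal_mul, ENNReal.toReal_mul,
    Measure.addHaar_ball volume 0 hr.le]
  simp only [finrank_euclideanSpace, Fintype.card_fin, ENNReal.toReal_mul]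
  rw [ENNReal.toReal_ofReal (by positivity), ENNReal.toReal_ofReal (by positivity),
    Real.div_rpow two_pos.le hr.le]
  ring

lemma FatAt.le_pCap {p : ℝ} (hp : 0 < p) {c : ℝ≥0} {K : Set (EuclideanSpace ℝ (Fin n))}
    {z : EuclideanSpace ℝ (Fin n)} {r : ℝ} (hr : 0 < r) (h : FatAt volume p c K z r) :
    c * (r ^ p)⁻¹ * (volume (closedBall z r)).toReal ≤
      pCap n p (K ∩ closedBall z r) (ball z (2 * r)) := by
  refine le_csInf ⟨_, ballCutoff_mem_pCap_set p hr Set.inter_subset_right⟩ ?_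
  rintro _ ⟨φ, ⟨L, hL⟩, hc, hU, hK, rfl⟩
  have h1 := h φ L hL hc hU hK
  rw [lintegral_enorm_fderiv_rpow_eq hp hL hc hU, ENNReal.ofReal_rpow_of_nonneg hr.le hp.le,
    ← ENNReal.ofReal_mul (by positivity)] at h1
  have h2 := ENNReal.toReal_mono ENNReal.ofReal_ne_top h1
  rw [ENNReal.toReal_ofReal (mul_nonneg (by positivity)
    (integral_nonneg fun y => by positivity)), ENNReal.toReal_mul, ENNReal.coe_toReal] at h2
  rw [mul_right_comm, ← div_eq_mul_inv, div_le_iff₀ (by positivity), mul_comm (∫ _ in _, _)]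
  exact h2

lemma fatAt_of_le_pCap {p : ℝ} (hp : 0 < p) {c : ℝ≥0} {K : Set (EuclideanSpace ℝ (Fin n))}
    {z : EuclideanSpace ℝ (Fin n)} {r : ℝ} (hr : 0 < r)
    (h : c * (r ^ p)⁻¹ * (volume (closedBall z r)).toReal ≤
      pCap n p (K ∩ closedBall z r) (ball z (2 * r))) : FatAt volume p c K z r := by
  intro φ L hL hc hU hK
  have h1 := h.trans (csInf_le (bddBelow_pCap_set _ _ _) ⟨φ, ⟨L, hL⟩, hc, hU, hK, rfl⟩)
  rw [mul_right_comm, ← div_eq_mul_inv, div_le_iff₀ (by positivity), mul_comm (∫ _ in _, _)] at h1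
  rw [lintegral_enorm_fderiv_rpow_eq hp hL hc hU, ENNReal.ofReal_rpow_of_nonneg hr.le hp.le,
    ← ENNReal.ofReal_mul (by positivity)]
  refine le_trans (le_of_eq ?_) (ENNReal.ofReal_le_ofReal h1)
  rw [ENNReal.ofReal_mul c.coe_nonneg, ENNReal.ofReal_coe_nnreal,
    ENNReal.ofReal_toReal measure_closedBall_lt_top.ne]

lemma exists_fatAt_univ (hn : n ≠ 0) {p : ℝ} (hp : 1 ≤ p) :
    ∃ c : ℝ≥0, 0 < c ∧ ∀ (z : EuclideanSpace ℝ (Fin n)) (r : ℝ), 0 < r →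
      FatAt volume p c Set.univ z r := by
  have : NeZero n := ⟨hn⟩
  have hM0 : 0 < (2 * 25 ^ n * 10 ^ p : ℝ≥0) := by positivity
  refine ⟨(2 * 25 ^ n * 10 ^ p)⁻¹, by positivity, fun z r hr φ L hL _ hU hK => ?_⟩
  have h1 := measure_le_lintegral_fderiv_of_half_le volume hL hr (z := z) (fun y hy => by
    exact image_eq_zero_of_notMem_tsupport fun hyt => hy (hU hyt)) subset_rfl
    (fun y hy => by linarith [hK y ⟨trivial, hy⟩]) hp
  rw [ENNReal.coe_inv hM0.ne', mul_comm, ← div_eq_mul_inv,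
    ENNReal.div_le_iff (by exact_mod_cast hM0.ne') ENNReal.coe_ne_top, mul_comm]
  refine h1.trans (le_of_eq ?_)
  rw [finrank_euclideanSpace, Fintype.card_fin]
  push_cast
  rw [ENNReal.coe_rpow_of_nonneg _ (by linarith)]
  rfl

end Capacity

/-- **Self-improvement of uniform fatness** (Theorem 3.3, Euclidean case): if `ℝⁿ∖Ω` is
uniformly `p`-fat with constants `c₀, r₀`, then it is uniformly `q`-fat with constants
`c₁, r₀` for some `1 < q < p`, where `q` and `c₁` depend only on `n`, `p` and `c₀`. -/
theorem fatness_self_improvement (n : ℕ) (hn : 3 ≤ n) (p c₀ : ℝ) (hp : 1 < p) (hc₀ : 0 < c₀) :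
    ∃ q c₁ : ℝ, 1 < q ∧ q < p ∧ 0 < c₁ ∧
      ∀ (Ω : Set (EuclideanSpace ℝ (Fin n))) (r₀ : ℝ), 0 < r₀ →
        Bornology.IsBounded Ω → IsConnected Ω → IsOpen Ω →
        UniformlyFat n p c₀ r₀ Ωᶜ → UniformlyFat n q c₁ r₀ Ωᶜ := by
  have hn0 : n ≠ 0 := by omega
  have : NeZero n := ⟨hn0⟩
  obtain ⟨b, hb, hball⟩ := exists_fatAt_univ hn0 hp.le
  lift c₀ to ℝ≥0 using hc₀.le
  obtain ⟨q, c', hq1, hqp, hc', H⟩ := exists_fatAt_of_fatAt (EuclideanSpace ℝ (Fin n)) volume hp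
    (c := c₀ * b) (mul_pos (by exact_mod_cast hc₀) hb)
  refine ⟨q, c' / (2 ^ q * 2 ^ n), hq1, hqp, by positivity, ?_⟩
  intro Ω r₀ _ _ _ hΩ hfat z hz r hr hrr
  have hp0 : 0 < p := by linarith
  have hq0 : 0 < q := by linarith
  have h1 := (H Ωᶜ r₀ hΩ.isClosed_compl (fun w hw d hd hdr => ?_) z hz r hr hrr).le_pCap hq0 hr
  · refine le_trans ?_ h1
    calc _ ≤ c' / (2 ^ q * 2 ^ n) *
          (2 ^ q * 2 ^ n * (r ^ q)⁻¹ * (volume (closedBall z r)).toReal) := by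
          gcongr
          exact pCap_ball_le hq0 z hr
      _ = _ := by field_simp
  · refine fatAt_of_le_pCap hp0 hd (le_trans ?_ (hfat w hw d hd hdr))
    have h2 := (hball w d hd).le_pCap hp0 hd
    rw [Set.univ_inter] at h2
    calc _ = c₀ * (b * (d ^ p)⁻¹ * (volume (closedBall w d)).toReal) := by push_cast; ring
      _ ≤ _ := by gcongr
end
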